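/- arXiv:1208.3283 — 7 statements merged into one kernel-verified Lean document; each statement's English description precedes it below -/
import Mathlib

section
/- Let m ≥ 3 be an integer, x₊ > 1, and let V : [x₊,∞) → ℝ be twice continuously differentiable with |V^{(k)}(x)| ≤ C₀ x^{-m-k} for all x ≥ x₊ and k = 0, 1, 2. Then for every ε ∈ ℂ with Re ε ≥ 0 there exists a unique twice continuously differentiable function s(·;ε) : [x₊,∞) → ℂ solving s'' − 2ε s' − V s = V on [x₊,∞) with s(x;ε) → 0 as x → ∞. Moreover, for each fixed x ≥ x₊, the map ε ↦ s(x;ε) is analytic on {Re ε > 0} and continuous on {Re ε ≥ 0}. -/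
open MeasureTheory Filter Set Real
open scoped Topology

/-- `s` (with first and second `x`-derivatives `sd`, `sdd` within `[x₊,∞)`) is a twice
continuously differentiable solution of `s'' − 2εs' − Vs = V` on `[x₊,∞)` with
`s(x) → 0` as `x → ∞`. -/
def SolvesS (V : ℝ → ℝ) (xP : ℝ) (ε : ℂ) (s sd sdd : ℝ → ℂ) : Prop :=
  (∀ x ∈ Set.Ici xP, HasDerivWithinAt s (sd x) (Set.Ici xP) x) ∧
  (∀ x ∈ Set.Ici xP, HasDerivWithinAt sd (sdd x) (Set.Ici xP) x) ∧
  ContinuousOn sdd (Set.Ici xP) ∧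
  (∀ x ∈ Set.Ici xP, sdd x - 2 * ε * sd x - (V x : ℂ) * s x = (V x : ℂ)) ∧
  Filter.Tendsto s Filter.atTop (nhds 0)

theorem differentiableOn_integral_of_dominated {α : Type*} [MeasurableSpace α] {μ : Measure α}
    {F : ℂ → α → ℂ} {U : Set ℂ} {b : α → ℝ} (hU : IsOpen U)
    (hmeas : ∀ z ∈ U, AEStronglyMeasurable (F z) μ)
    (hbound : ∀ᵐ t ∂μ, ∀ z ∈ U, ‖F z t‖ ≤ b t) (hb : Integrable b μ)
    (hd : ∀ᵐ t ∂μ, DifferentiableOn ℂ (fun z => F z t) U) :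
    DifferentiableOn ℂ (fun z => ∫ t, F z t ∂μ) U := by
  intro z₀ hz₀
  obtain ⟨R, hR, hRU⟩ := Metric.isOpen_iff.1 hU z₀ hz₀
  have hr : 0 < R / 2 := by positivity
  have hsub : ∀ z ∈ Metric.ball z₀ (R / 2), Metric.closedBall z (R / 2) ⊆ U := by
    refine fun z hz w hw => hRU ?_
    have := dist_triangle w z z₀
    simp only [Metric.mem_ball, Metric.mem_closedBall] at *
    linarith
  have hderiv : ∀ᵐ t ∂μ, ∀ z ∈ Metric.ball z₀ (R / 2),
      HasDerivAt (fun z => F z t) (deriv (fun z => F z t) z) z := by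
    filter_upwards [hd] with t ht z hz
    exact (ht.differentiableAt (hU.mem_nhds
      (hsub z hz (Metric.mem_closedBall_self hr.le)))).hasDerivAt
  refine (hasDerivAt_integral_of_dominated_loc_of_deriv_le (Metric.ball_mem_nhds z₀ hr)
    (F' := fun z t => deriv (fun z => F z t) z) (bound := fun t => b t / (R / 2))
    ?_ ?_ ?_ ?_ (hb.div_const _) hderiv).2.differentiableAt.differentiableWithinAt
  · filter_upwards [hU.mem_nhds hz₀] with z hz using hmeas z hz
  · exact hb.mono' (hmeas z₀ hz₀) (hbound.mono fun t ht => ht z₀ hz₀)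
  · obtain ⟨h, hh⟩ := exists_seq_tendsto (𝓝[≠] z₀)
    have hhU : ∀ᶠ n in atTop, h n ∈ U :=
      (hh.mono_right nhdsWithin_le_nhds).eventually (hU.mem_nhds hz₀)
    obtain ⟨N, hN⟩ := eventually_atTop.1 hhU
    refine aestronglyMeasurable_of_tendsto_ae (u := atTop)
      (f := fun n t => slope (fun z => F z t) z₀ (h (n + N))) (fun n => ?_) ?_
    · simp only [slope, vsub_eq_sub]
      exact ((hmeas _ (hN (n + N) (by lia))).sub (hmeas _ hz₀)).const_smul (h (n + N) - z₀)⁻¹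
    · filter_upwards [hderiv] with t ht
      exact (hasDerivAt_iff_tendsto_slope.1 (ht z₀ (Metric.mem_ball_self hr))).comp
        (hh.comp (tendsto_add_atTop_nat N))
  · filter_upwards [hd, hbound] with t ht hbt z hz
    refine Complex.norm_deriv_le_of_forall_mem_sphere_norm_le hr
      (ht.diffContOnCl_ball (hsub z hz)) fun w hw =>
        hbt w (hsub z hz (Metric.sphere_subset_closedBall hw))

theorem hasDerivAt_neg_inv_pow (x : ℝ) (k : ℕ) {u : ℝ} (h : x + u ≠ 0) :
    HasDerivAt (fun u : ℝ => -(((x + u) ^ (k + 1))⁻¹ / (k + 1))) ((x + u) ^ (k + 2))⁻¹ u := by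
  have h1 : HasDerivAt (fun u : ℝ => (x + u) ^ (k + 1)) ((k + 1) * (x + u) ^ k) u := by
    simpa using ((hasDerivAt_id u).const_add x).fun_pow (k + 1)
  have : (k : ℝ) + 1 ≠ 0 := by positivity
  refine ((h1.fun_inv (pow_ne_zero _ h)).div_const ((k : ℝ) + 1)).fun_neg.congr_deriv ?_
  field_simp
  ring

theorem tendsto_neg_inv_pow (x : ℝ) (k : ℕ) :
    Tendsto (fun u : ℝ => -(((x + u) ^ (k + 1))⁻¹ / (k + 1))) atTop (𝓝 0) := by
  have h := tendsto_inv_atTop_zero.comp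
    ((tendsto_pow_atTop (Nat.succ_ne_zero k)).comp (tendsto_atTop_add_const_left atTop x tendsto_id))
  simpa using (h.div_const ((k : ℝ) + 1)).neg

theorem integrableOn_inv_pow {x : ℝ} (hx : 0 < x) (k : ℕ) :
    IntegrableOn (fun u : ℝ => ((x + u) ^ (k + 2))⁻¹) (Ioi 0) :=
  integrableOn_Ioi_deriv_of_nonneg'
    (fun _ hu => hasDerivAt_neg_inv_pow x k (add_pos_of_pos_of_nonneg hx hu).ne')
    (fun _ hu => inv_nonneg.2 (pow_nonneg (add_pos hx hu).le _)) (tendsto_neg_inv_pow x k)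

theorem integral_inv_pow {x : ℝ} (hx : 0 < x) (k : ℕ) :
    ∫ u in Ioi (0 : ℝ), ((x + u) ^ (k + 2))⁻¹ = (x ^ (k + 1))⁻¹ / (k + 1) := by
  have := integral_Ioi_of_hasDerivAt_of_nonneg'
    (fun _ hu => hasDerivAt_neg_inv_pow x k (add_pos_of_pos_of_nonneg hx hu).ne')
    (fun _ hu => inv_nonneg.2 (pow_nonneg (add_pos hx hu).le _)) (tendsto_neg_inv_pow x k)
  simpa using this

/-- The solution operator `g ↦ ∫_x^∞ e^{-σ(t-x)} g(t) dt` of `p' = σ p - g`. -/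
noncomputable def expTail (σ : ℂ) (g : ℝ → ℂ) (x : ℝ) : ℂ :=
  ∫ u in Ioi (0 : ℝ), Complex.exp (-(σ * u)) * g (x + u)

theorem norm_exp_neg_mul_le {σ : ℂ} (hσ : 0 ≤ σ.re) {u : ℝ} (hu : 0 ≤ u) :
    ‖Complex.exp (-(σ * u))‖ ≤ 1 := by
  rw [Complex.norm_exp]
  simpa using mul_nonneg hσ hu

theorem continuousOn_exp_mul_shift {a : ℝ} {g : ℝ → ℂ} (hg : ContinuousOn g (Ici a)) (σ : ℂ)
    {x : ℝ} (hx : a ≤ x) :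
    ContinuousOn (fun u : ℝ => Complex.exp (-(σ * u)) * g (x + u)) (Ici 0) := by
  refine ContinuousOn.mul (by fun_prop) (hg.comp (by fun_prop) fun u hu => ?_)
  simp only [mem_Ici] at *
  linarith

theorem aestronglyMeasurable_exp_mul_shift {a : ℝ} {g : ℝ → ℂ} (hg : ContinuousOn g (Ici a))
    (σ : ℂ) {x : ℝ} (hx : a ≤ x) :
    AEStronglyMeasurable (fun u : ℝ => Complex.exp (-(σ * u)) * g (x + u))
      (volume.restrict (Ioi 0)) :=
  ((continuousOn_exp_mul_shift hg σ hx).mono Ioi_subset_Ici_self).aestronglyMeasurable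
    measurableSet_Ioi

theorem norm_exp_mul_shift_le {a M : ℝ} {k : ℕ} {g : ℝ → ℂ}
    (hM : ∀ x, a ≤ x → ‖g x‖ ≤ M / x ^ k) {σ : ℂ} (hσ : 0 ≤ σ.re) {x u : ℝ} (hx : a ≤ x)
    (hu : 0 ≤ u) : ‖Complex.exp (-(σ * u)) * g (x + u)‖ ≤ M * ((x + u) ^ k)⁻¹ := by
  rw [norm_mul, ← div_eq_mul_inv]
  exact (mul_le_of_le_one_left (norm_nonneg _) (norm_exp_neg_mul_le hσ hu)).trans
    (hM _ (by linarith))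

theorem integrableOn_exp_mul_shift {a M : ℝ} (ha : 0 < a) {k : ℕ} {g : ℝ → ℂ}
    (hg : ContinuousOn g (Ici a)) (hM : ∀ x, a ≤ x → ‖g x‖ ≤ M / x ^ (k + 2)) {σ : ℂ}
    (hσ : 0 ≤ σ.re) {x : ℝ} (hx : a ≤ x) :
    IntegrableOn (fun u : ℝ => Complex.exp (-(σ * u)) * g (x + u)) (Ioi 0) :=
  ((integrableOn_inv_pow (ha.trans_le hx) k).const_mul M).mono'
    (aestronglyMeasurable_exp_mul_shift hg σ hx)
    ((ae_restrict_mem measurableSet_Ioi).mono fun _ hu =>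
      norm_exp_mul_shift_le hM hσ hx (le_of_lt hu))

theorem norm_expTail_le {a M : ℝ} (ha : 0 < a) {k : ℕ} {g : ℝ → ℂ}
    (hM : ∀ x, a ≤ x → ‖g x‖ ≤ M / x ^ (k + 2)) {σ : ℂ} (hσ : 0 ≤ σ.re) {x : ℝ} (hx : a ≤ x) :
    ‖expTail σ g x‖ ≤ M / (k + 1) / x ^ (k + 1) := by
  have := norm_integral_le_of_norm_le ((integrableOn_inv_pow (ha.trans_le hx) k).const_mul M)
    ((ae_restrict_mem measurableSet_Ioi).mono fun _ hu =>
      norm_exp_mul_shift_le hM hσ hx (le_of_lt hu))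
  rw [integral_const_mul, integral_inv_pow (ha.trans_le hx)] at this
  refine this.trans_eq ?_
  ring

theorem expTail_sub {a M N : ℝ} (ha : 0 < a) {k : ℕ} {g h : ℝ → ℂ}
    (hg : ContinuousOn g (Ici a)) (hM : ∀ x, a ≤ x → ‖g x‖ ≤ M / x ^ (k + 2))
    (hh : ContinuousOn h (Ici a)) (hN : ∀ x, a ≤ x → ‖h x‖ ≤ N / x ^ (k + 2))
    {σ : ℂ} (hσ : 0 ≤ σ.re) {x : ℝ} (hx : a ≤ x) :
    expTail σ (fun t => g t - h t) x = expTail σ g x - expTail σ h x := by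
  simp only [expTail, mul_sub]
  exact integral_sub (integrableOn_exp_mul_shift ha hg hM hσ hx)
    (integrableOn_exp_mul_shift ha hh hN hσ hx)

theorem expTail_congr {a : ℝ} {g h : ℝ → ℂ} (hgh : EqOn g h (Ici a)) (σ : ℂ) :
    EqOn (expTail σ g) (expTail σ h) (Ici a) := by
  refine fun x hx => setIntegral_congr_fun measurableSet_Ioi fun u hu => ?_
  simp only [mem_Ici, mem_Ioi] at hx hu
  simp only [hgh (show x + u ∈ Ici a by simp only [mem_Ici]; linarith)]

theorem hasDerivWithinAt_expTail {a M : ℝ} (ha : 0 < a) {g : ℝ → ℂ}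
    (hg : ContinuousOn g (Ici a)) (hM : ∀ x, a ≤ x → ‖g x‖ ≤ M / x ^ 2) {σ : ℂ}
    (hσ : 0 ≤ σ.re) {x : ℝ} (hx : a ≤ x) :
    HasDerivWithinAt (expTail σ g) (σ * expTail σ g x - g x) (Ici a) x := by
  set G : ℝ → ℂ := fun t => Complex.exp (-(σ * t)) * g (max t a) with hG
  have hGc : Continuous G := by
    refine Continuous.mul (by fun_prop) (hg.comp_continuous (by fun_prop) fun t => ?_)
    exact le_max_right t a
  have hshift : ∀ y : ℝ, a ≤ y → ∀ u : ℝ, 0 < u →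
      Complex.exp (-(σ * u)) * g (y + u) = Complex.exp (σ * y) * G (u + y) := by
    intro y hy u hu
    simp only [hG]
    rw [max_eq_left (by linarith), add_comm u y, ← mul_assoc, ← Complex.exp_add]
    push_cast
    ring_nf
  have hGi : IntegrableOn G (Ioi a) := by
    have h := (integrableOn_exp_mul_shift ha (k := 0) hg (by simpa using hM) hσ le_rfl).congr_fun
      (fun u hu => hshift a le_rfl u hu) measurableSet_Ioi
    have h' := h.const_mul (Complex.exp (-(σ * a)))
    have : IntegrableOn (fun u => G (u + a)) (Ioi 0) := by
      refine h'.congr (ae_of_all _ fun u => ?_)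
      simp only [← mul_assoc, ← Complex.exp_add]
      simp
    have h3 := (measurePreserving_add_right volume a).integrableOn_comp_preimage
      (measurableEmbedding_addRight a) (f := G) (s := Ioi a)
    simp only [preimage_add_const_Ioi, sub_self] at h3
    exact h3.1 this
  have hrep : ∀ y : ℝ, a ≤ y → expTail σ g y =
      Complex.exp (σ * y) * ((∫ t in Ioi a, G t) - ∫ t in a..y, G t) := by
    intro y hy
    rw [expTail, setIntegral_congr_fun measurableSet_Ioi (fun u hu => hshift y hy u hu),
      integral_const_mul, ← intervalIntegral.integral_Ioi_sub_Ioi hGi hy, sub_sub_cancel]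
    have := (measurePreserving_add_right volume y).setIntegral_preimage_emb
      (measurableEmbedding_addRight y) G (Ioi y)
    simp only [preimage_add_const_Ioi, sub_self] at this
    rw [this]
  have h1 : HasDerivAt (fun y : ℝ => ∫ t in a..y, G t) (G x) x :=
    intervalIntegral.integral_hasDerivAt_right (hGc.intervalIntegrable _ _)
      (hGc.stronglyMeasurableAtFilter _ _) hGc.continuousAt
  have h2 : HasDerivAt (fun y : ℝ => Complex.exp (σ * y)) (Complex.exp (σ * x) * σ) x := by
    simpa using (((hasDerivAt_id x).ofReal_comp).const_mul σ).cexp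
  refine ((h2.mul (h1.const_sub (∫ t in Ioi a, G t))).hasDerivWithinAt.congr_of_mem
    (fun y hy => hrep y hy) hx).congr_deriv ?_
  rw [hrep x hx]
  have : Complex.exp (σ * x) * G x = g x := by
    simp only [hG, max_eq_left hx, ← mul_assoc, ← Complex.exp_add]
    simp
  linear_combination -this

theorem continuousOn_expTail {a M : ℝ} (ha : 0 < a) {g : ℝ → ℂ}
    (hg : ContinuousOn g (Ici a)) (hM : ∀ x, a ≤ x → ‖g x‖ ≤ M / x ^ 2) {σ : ℂ}
    (hσ : 0 ≤ σ.re) : ContinuousOn (expTail σ g) (Ici a) := fun _ hx =>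
  (hasDerivWithinAt_expTail ha hg hM hσ hx).continuousWithinAt

theorem div_pow_le_div_pow_of_le {M x : ℝ} (hM : 0 ≤ M) (hx : 1 ≤ x) {j k : ℕ} (h : j ≤ k) :
    M / x ^ k ≤ M / x ^ j :=
  div_le_div_of_nonneg_left hM (by positivity) (pow_le_pow_right₀ hx h)

/-- The Volterra operator whose fixed-point equation `w = 1 + voltOp V ε w` is the integrated form
of `w'' - 2 ε w' = V w`, `w → 1`. -/
noncomputable def voltOp (V : ℝ → ℂ) (ε : ℂ) (f : ℝ → ℂ) : ℝ → ℂ :=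
  expTail 0 (expTail (2 * ε) (fun t => V t * f t))

theorem two_mul_re_nonneg {ε : ℂ} (hε : 0 ≤ ε.re) : 0 ≤ (2 * ε).re := by
  simpa using hε

section Volterra

variable {a C : ℝ} {V : ℝ → ℂ} {ε : ℂ}

theorem norm_potential_mul_le (ha : 1 ≤ a) (hV : ∀ x, a ≤ x → ‖V x‖ ≤ C / x ^ 3) {M : ℝ} {k : ℕ}
    {f : ℝ → ℂ} (hM : ∀ x, a ≤ x → ‖f x‖ ≤ M / x ^ k) (x : ℝ) (hx : a ≤ x) :
    ‖V x * f x‖ ≤ C * M / x ^ (k + 1 + 2) := by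
  rw [norm_mul]
  have hx0 : 0 < x := by linarith
  refine (mul_le_mul (hV x hx) (hM x hx) (norm_nonneg _)
    ((norm_nonneg _).trans (hV x hx))).trans_eq ?_
  rw [div_mul_div_comm, ← pow_add]
  congr 2
  ring

theorem norm_expTail_potential_mul_le (ha : 1 ≤ a) (hC : 0 ≤ C)
    (hV : ∀ x, a ≤ x → ‖V x‖ ≤ C / x ^ 3) (hε : 0 ≤ ε.re) {M : ℝ} (hM0 : 0 ≤ M) {k : ℕ}
    {f : ℝ → ℂ} (hM : ∀ x, a ≤ x → ‖f x‖ ≤ M / x ^ k) (x : ℝ) (hx : a ≤ x) :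
    ‖expTail (2 * ε) (fun t => V t * f t) x‖ ≤ C * M / x ^ (k + 2) := by
  refine (norm_expTail_le (by linarith) (norm_potential_mul_le ha hV hM)
    (two_mul_re_nonneg hε) hx).trans ?_
  have hx0 : 0 < x := by linarith
  gcongr
  · exact div_le_self (by positivity) (by push_cast; linarith [k.cast_nonneg (α := ℝ)])

theorem norm_voltOp_le (ha : 1 ≤ a) (hC : 0 ≤ C) (hV : ∀ x, a ≤ x → ‖V x‖ ≤ C / x ^ 3)
    (hε : 0 ≤ ε.re) {M : ℝ} (hM0 : 0 ≤ M) {k : ℕ} {f : ℝ → ℂ}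
    (hM : ∀ x, a ≤ x → ‖f x‖ ≤ M / x ^ k) (x : ℝ) (hx : a ≤ x) :
    ‖voltOp V ε f x‖ ≤ C * M / (k + 1) / x ^ (k + 1) :=
  norm_expTail_le (by linarith) (norm_expTail_potential_mul_le ha hC hV hε hM0 hM)
    (by simp) hx

theorem norm_expTail_potential_mul_le_sq (ha : 1 ≤ a) (hC : 0 ≤ C)
    (hV : ∀ x, a ≤ x → ‖V x‖ ≤ C / x ^ 3) (hε : 0 ≤ ε.re) {M : ℝ} (hM0 : 0 ≤ M)
    {f : ℝ → ℂ} (hM : ∀ x, a ≤ x → ‖f x‖ ≤ M) (x : ℝ) (hx : a ≤ x) :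
    ‖expTail (2 * ε) (fun t => V t * f t) x‖ ≤ C * M / x ^ 2 :=
  norm_expTail_potential_mul_le ha hC hV hε hM0 (k := 0) (by simpa using hM) x hx

theorem norm_potential_mul_le_sq (ha : 1 ≤ a) (hC : 0 ≤ C)
    (hV : ∀ x, a ≤ x → ‖V x‖ ≤ C / x ^ 3) {M : ℝ} (hM0 : 0 ≤ M)
    {f : ℝ → ℂ} (hM : ∀ x, a ≤ x → ‖f x‖ ≤ M) (x : ℝ) (hx : a ≤ x) :
    ‖V x * f x‖ ≤ C * M / x ^ 2 :=
  (norm_potential_mul_le ha hV (k := 0) (by simpa using hM) x hx).trans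
    (div_pow_le_div_pow_of_le (by positivity) (ha.trans hx) (by lia))

theorem hasDerivWithinAt_expTail_potential_mul (ha : 1 ≤ a) (hC : 0 ≤ C)
    (hVc : ContinuousOn V (Ici a)) (hV : ∀ x, a ≤ x → ‖V x‖ ≤ C / x ^ 3) (hε : 0 ≤ ε.re)
    {M : ℝ} (hM0 : 0 ≤ M) {f : ℝ → ℂ} (hf : ContinuousOn f (Ici a))
    (hM : ∀ x, a ≤ x → ‖f x‖ ≤ M) {x : ℝ} (hx : a ≤ x) :
    HasDerivWithinAt (expTail (2 * ε) (fun t => V t * f t))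
      (2 * ε * expTail (2 * ε) (fun t => V t * f t) x - V x * f x) (Ici a) x :=
  hasDerivWithinAt_expTail (by linarith) (hVc.mul hf) (norm_potential_mul_le_sq ha hC hV hM0 hM)
    (two_mul_re_nonneg hε) hx

theorem hasDerivWithinAt_voltOp (ha : 1 ≤ a) (hC : 0 ≤ C)
    (hVc : ContinuousOn V (Ici a)) (hV : ∀ x, a ≤ x → ‖V x‖ ≤ C / x ^ 3) (hε : 0 ≤ ε.re)
    {M : ℝ} (hM0 : 0 ≤ M) {f : ℝ → ℂ} (hf : ContinuousOn f (Ici a))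
    (hM : ∀ x, a ≤ x → ‖f x‖ ≤ M) {x : ℝ} (hx : a ≤ x) :
    HasDerivWithinAt (voltOp V ε f) (-expTail (2 * ε) (fun t => V t * f t) x) (Ici a) x := by
  have := hasDerivWithinAt_expTail (σ := 0) (by linarith)
    (fun y hy => (hasDerivWithinAt_expTail_potential_mul ha hC hVc hV hε hM0 hf hM
      hy).continuousWithinAt)
    (norm_expTail_potential_mul_le_sq ha hC hV hε hM0 hM) (by simp) hx
  simpa [voltOp] using this

theorem voltOp_sub (ha : 1 ≤ a) (hC : 0 ≤ C)
    (hVc : ContinuousOn V (Ici a)) (hV : ∀ x, a ≤ x → ‖V x‖ ≤ C / x ^ 3) (hε : 0 ≤ ε.re)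
    {M N : ℝ} (hM0 : 0 ≤ M) (hN0 : 0 ≤ N) {f g : ℝ → ℂ} (hf : ContinuousOn f (Ici a))
    (hM : ∀ x, a ≤ x → ‖f x‖ ≤ M) (hg : ContinuousOn g (Ici a)) (hN : ∀ x, a ≤ x → ‖g x‖ ≤ N)
    {x : ℝ} (hx : a ≤ x) :
    voltOp V ε (fun t => f t - g t) x = voltOp V ε f x - voltOp V ε g x := by
  have ha0 : 0 < a := by linarith
  have hinner : EqOn (expTail (2 * ε) (fun t => V t * (f t - g t)))
      (fun y => expTail (2 * ε) (fun t => V t * f t) y - expTail (2 * ε) (fun t => V t * g t) y)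
      (Ici a) := by
    intro y hy
    simp only [mul_sub]
    exact expTail_sub (k := 0) ha0 (hVc.mul hf) (norm_potential_mul_le_sq ha hC hV hM0 hM)
      (hVc.mul hg) (norm_potential_mul_le_sq ha hC hV hN0 hN) (two_mul_re_nonneg hε) hy
  rw [voltOp, expTail_congr hinner 0 hx]
  exact expTail_sub (k := 0) ha0
    (fun y hy => (hasDerivWithinAt_expTail_potential_mul ha hC hVc hV hε hM0 hf hM
      hy).continuousWithinAt)
    (norm_expTail_potential_mul_le_sq ha hC hV hε hM0 hM)
    (fun y hy => (hasDerivWithinAt_expTail_potential_mul ha hC hVc hV hε hN0 hg hN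
      hy).continuousWithinAt)
    (norm_expTail_potential_mul_le_sq ha hC hV hε hN0 hN) (by simp) hx

end Volterra

/-- A family `f ε x`, jointly continuous on `{Re ε ≥ 0} × [a, ∞)`, bounded by `M / x ^ k`, and
holomorphic in `ε` on `{Re ε > 0}`. -/
structure IsHolFamily (a M : ℝ) (k : ℕ) (f : ℂ → ℝ → ℂ) : Prop where
  continuousOn : ContinuousOn (fun p : ℂ × ℝ => f p.1 p.2) ({ε : ℂ | 0 ≤ ε.re} ×ˢ Ici a)
  norm_le : ∀ ε : ℂ, 0 ≤ ε.re → ∀ x, a ≤ x → ‖f ε x‖ ≤ M / x ^ k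
  differentiableOn : ∀ x, a ≤ x → DifferentiableOn ℂ (fun ε => f ε x) {ε : ℂ | 0 < ε.re}

theorem isOpen_re_pos : IsOpen {ε : ℂ | 0 < ε.re} :=
  isOpen_lt continuous_const Complex.continuous_re

namespace IsHolFamily

variable {a M : ℝ} {k : ℕ} {f : ℂ → ℝ → ℂ}

theorem continuousOn_right (hf : IsHolFamily a M k f) {ε : ℂ} (hε : 0 ≤ ε.re) :
    ContinuousOn (f ε) (Ici a) :=
  hf.continuousOn.comp (f := fun x => (ε, x)) (by fun_prop) fun _ hx => ⟨hε, hx⟩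

theorem continuousOn_left (hf : IsHolFamily a M k f) {x : ℝ} (hx : a ≤ x) :
    ContinuousOn (fun ε => f ε x) {ε : ℂ | 0 ≤ ε.re} :=
  hf.continuousOn.comp (f := fun ε => (ε, x)) (by fun_prop) fun _ hε => ⟨hε, hx⟩

theorem expTail (ha : 0 < a) (hM : 0 ≤ M) (hf : IsHolFamily a M (k + 2) f) {c : ℝ} (hc : 0 ≤ c) :
    IsHolFamily a (M / (k + 1)) (k + 1) fun ε => expTail (c * ε) (f ε) := by
  have hre : ∀ {ε : ℂ}, 0 ≤ ε.re → 0 ≤ ((c : ℂ) * ε).re := fun hε => by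
    simpa using mul_nonneg hc hε
  refine ⟨?_, fun ε hε x hx => norm_expTail_le ha (hf.norm_le ε hε) (hre hε) hx, fun x hx => ?_⟩
  · refine continuousOn_of_dominated (bound := fun u => M * ((a + u) ^ (k + 2))⁻¹)
      (fun p hp => aestronglyMeasurable_exp_mul_shift (hf.continuousOn_right hp.1) _ hp.2)
      (fun p hp => (ae_restrict_mem measurableSet_Ioi).mono fun u hu => ?_)
      ((integrableOn_inv_pow ha k).const_mul M)
      ((ae_restrict_mem measurableSet_Ioi).mono fun u hu => ?_)
    · have hu0 : 0 < u := hu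
      have hpa : a ≤ p.2 := hp.2
      refine (norm_exp_mul_shift_le (hf.norm_le _ hp.1) (hre hp.1) hp.2 hu0.le).trans ?_
      gcongr
    · refine ContinuousOn.mul (by fun_prop) (hf.continuousOn.comp
        (f := fun p : ℂ × ℝ => (p.1, p.2 + u)) (by fun_prop) fun p hp => ⟨hp.1, ?_⟩)
      have hu0 : 0 < u := hu
      have hpa : a ≤ p.2 := hp.2
      simp only [mem_Ici]
      linarith
  · refine differentiableOn_integral_of_dominated isOpen_re_pos
      (b := fun u => M * ((x + u) ^ (k + 2))⁻¹)
      (fun ε hε => aestronglyMeasurable_exp_mul_shift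
        (hf.continuousOn_right (le_of_lt hε)) _ hx)
      ((ae_restrict_mem measurableSet_Ioi).mono fun u hu ε hε => ?_)
      ((integrableOn_inv_pow (ha.trans_le hx) k).const_mul M)
      ((ae_restrict_mem measurableSet_Ioi).mono fun u hu => ?_)
    · exact norm_exp_mul_shift_le (hf.norm_le _ (le_of_lt hε)) (hre (le_of_lt hε)) hx
        (le_of_lt hu)
    · exact DifferentiableOn.mul (by fun_prop)
        (hf.differentiableOn _ (hx.trans (le_add_of_nonneg_right (le_of_lt hu))))

theorem mono {N : ℝ} (hf : IsHolFamily a M k f) (ha : 0 ≤ a) (h : M ≤ N) : IsHolFamily a N k f :=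
  ⟨hf.continuousOn, fun ε hε x hx => (hf.norm_le ε hε x hx).trans (by
    have := ha.trans hx
    gcongr), hf.differentiableOn⟩

theorem potential_mul {C : ℝ} {V : ℝ → ℂ} (ha : 1 ≤ a) (hVc : ContinuousOn V (Ici a))
    (hV : ∀ x, a ≤ x → ‖V x‖ ≤ C / x ^ 3) (hf : IsHolFamily a M k f) :
    IsHolFamily a (C * M) (k + 1 + 2) fun ε t => V t * f ε t :=
  ⟨(hVc.comp continuousOn_snd fun _ hp => hp.2).mul hf.continuousOn,
    fun ε hε => norm_potential_mul_le ha hV (hf.norm_le ε hε),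
    fun x hx => (hf.differentiableOn x hx).const_mul _⟩

theorem voltOp {C : ℝ} {V : ℝ → ℂ} (ha : 1 ≤ a) (hC : 0 ≤ C) (hM : 0 ≤ M)
    (hVc : ContinuousOn V (Ici a)) (hV : ∀ x, a ≤ x → ‖V x‖ ≤ C / x ^ 3)
    (hf : IsHolFamily a M k f) :
    IsHolFamily a (C * M / (k + 1)) (k + 1) fun ε => voltOp V ε (f ε) := by
  have ha0 : 0 < a := by linarith
  have h1 := ((hf.potential_mul ha hVc hV).expTail ha0 (by positivity) zero_le_two).mono
    (N := C * M) ha0.le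
    (div_le_self (by positivity) (by push_cast; linarith [k.cast_nonneg (α := ℝ)]))
  simpa [_root_.voltOp] using h1.expTail ha0 (by positivity) le_rfl

end IsHolFamily

/-- Picard iterates of `w = 1 + voltOp V ε w`. -/
noncomputable def picardIter (V : ℝ → ℂ) : ℕ → ℂ → ℝ → ℂ
  | 0 => fun _ _ => 1
  | n + 1 => fun ε => voltOp V ε (picardIter V n ε)

section Picard

variable {a C : ℝ} {V : ℝ → ℂ}

theorem isHolFamily_picardIter (ha : 1 ≤ a) (hC : 0 ≤ C) (hVc : ContinuousOn V (Ici a))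
    (hV : ∀ x, a ≤ x → ‖V x‖ ≤ C / x ^ 3) (n : ℕ) :
    IsHolFamily a (C ^ n / n.factorial) n (picardIter V n) := by
  induction n with
  | zero =>
    exact ⟨continuousOn_const, fun _ _ _ _ => by simp [picardIter], fun _ _ => by
      simpa only [picardIter] using differentiableOn_const 1⟩
  | succ n ih =>
    refine (ih.voltOp ha hC (by positivity) hVc hV).mono (by linarith) (le_of_eq ?_)
    rw [Nat.factorial_succ]
    push_cast
    field_simp
    ring

theorem norm_picardIter_le (ha : 1 ≤ a) (hC : 0 ≤ C) (hVc : ContinuousOn V (Ici a))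
    (hV : ∀ x, a ≤ x → ‖V x‖ ≤ C / x ^ 3) (n : ℕ) {ε : ℂ} (hε : 0 ≤ ε.re) {x : ℝ} (hx : a ≤ x) :
    ‖picardIter V n ε x‖ ≤ C ^ n / n.factorial := by
  refine ((isHolFamily_picardIter ha hC hVc hV n).norm_le ε hε x hx).trans ?_
  simpa using div_pow_le_div_pow_of_le (by positivity : 0 ≤ C ^ n / n.factorial) (ha.trans hx)
    n.zero_le

/-- The sum of the Picard iterates. -/
noncomputable def picardSum (V : ℝ → ℂ) (ε : ℂ) (x : ℝ) : ℂ := ∑' n, picardIter V n ε x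

theorem isHolFamily_picardSum (ha : 1 ≤ a) (hC : 0 ≤ C) (hVc : ContinuousOn V (Ici a))
    (hV : ∀ x, a ≤ x → ‖V x‖ ≤ C / x ^ 3) :
    IsHolFamily a (∑' n : ℕ, C ^ n / n.factorial) 0 (picardSum V) where
  continuousOn := continuousOn_tsum (fun n => (isHolFamily_picardIter ha hC hVc hV n).continuousOn)
    (Real.summable_pow_div_factorial C) fun n _ hp => norm_picardIter_le ha hC hVc hV n hp.1 hp.2
  norm_le ε hε x hx := by
    simpa [picardSum] using tsum_of_norm_bounded (Real.summable_pow_div_factorial C).hasSum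
      fun n => norm_picardIter_le ha hC hVc hV n hε hx
  differentiableOn x hx := Complex.differentiableOn_tsum_of_summable_norm
    (Real.summable_pow_div_factorial C)
    (fun n => (isHolFamily_picardIter ha hC hVc hV n).differentiableOn x hx) isOpen_re_pos
    fun n _ hε => norm_picardIter_le ha hC hVc hV n (le_of_lt hε) hx

theorem picardSum_eq_one_add_voltOp (ha : 1 ≤ a) (hC : 0 ≤ C) (hVc : ContinuousOn V (Ici a))
    (hV : ∀ x, a ≤ x → ‖V x‖ ≤ C / x ^ 3) {ε : ℂ} (hε : 0 ≤ ε.re) {x : ℝ} (hx : a ≤ x) :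
    picardSum V ε x = 1 + voltOp V ε (picardSum V ε) x := by
  have hsum := Real.summable_pow_div_factorial C
  set R : ℕ → ℝ := fun n => ∑' k : ℕ, C ^ (k + n) / (k + n).factorial with hR
  set r : ℕ → ℝ → ℂ := fun n t => picardSum V ε t - ∑ k ∈ Finset.range n, picardIter V k ε t with hr
  have hps : ∀ t, a ≤ t → Summable fun n => picardIter V n ε t := fun t ht =>
    hsum.of_norm_bounded fun n => norm_picardIter_le ha hC hVc hV n hε ht
  have hrle : ∀ n t, a ≤ t → ‖r n t‖ ≤ R n := by
    intro n t ht
    have : r n t = ∑' k, picardIter V (k + n) ε t := by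
      simp only [hr, picardSum, ← (hps t ht).sum_add_tsum_nat_add n, add_sub_cancel_left]
    rw [this]
    exact tsum_of_norm_bounded ((summable_nat_add_iff n).2 hsum).hasSum
      fun k => norm_picardIter_le ha hC hVc hV _ hε ht
  have hR0 : ∀ n, 0 ≤ R n := fun n => tsum_nonneg fun k => by positivity
  have hpc : ∀ n, ContinuousOn (picardIter V n ε) (Ici a) := fun n =>
    (isHolFamily_picardIter ha hC hVc hV n).continuousOn_right hε
  have hrc : ∀ n, ContinuousOn (r n) (Ici a) := fun n =>
    ((isHolFamily_picardSum ha hC hVc hV).continuousOn_right hε).sub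
      (continuousOn_finsetSum _ fun k _ => hpc k)
  have hrec : ∀ n, voltOp V ε (picardSum V ε) x - ∑ k ∈ Finset.range n, picardIter V (k + 1) ε x
      = voltOp V ε (r n) x := by
    intro n
    induction n with
    | zero => simp [hr]
    | succ n ih =>
      have hsucc : r (n + 1) = fun t => r n t - picardIter V n ε t := by
        ext t
        simp only [hr, Finset.sum_range_succ]
        ring
      rw [hsucc, voltOp_sub ha hC hVc hV hε (hR0 n) (by positivity) (hrc n) (hrle n) (hpc n)
        (fun t ht => norm_picardIter_le ha hC hVc hV n hε ht) hx, ← ih, Finset.sum_range_succ]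
      simp only [picardIter]
      ring
  have hlim : Tendsto (fun n => voltOp V ε (r n) x) atTop (𝓝 0) := by
    refine squeeze_zero_norm (fun n => ?_)
      (by simpa using (tendsto_sum_nat_add fun n : ℕ => C ^ n / n.factorial).const_mul C)
    have h := norm_voltOp_le ha hC hV hε (hR0 n) (k := 0) (f := r n)
      (by simpa using hrle n) x hx
    have hCR := mul_nonneg hC (hR0 n)
    refine h.trans ?_
    simpa using div_pow_le_div_pow_of_le hCR (ha.trans hx) (Nat.zero_le 1)
  have htend := ((summable_nat_add_iff 1).2 (hps x hx)).hasSum.tendsto_sum_nat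
  have hlim' := (htend.const_sub (voltOp V ε (picardSum V ε) x)).congr hrec
  have hz := tendsto_nhds_unique hlim' hlim
  rw [picardSum, (hps x hx).tsum_eq_zero_add, ← sub_eq_zero.1 hz]
  simp [picardIter]

end Picard

theorem eqOn_of_hasDerivWithinAt_zero {a : ℝ} {f : ℝ → ℂ}
    (hf : ∀ x, a ≤ x → HasDerivWithinAt f 0 (Ici a) x) {x y : ℝ} (hx : a ≤ x) (hy : a ≤ y) :
    f x = f y := by
  have := (convex_Ici a).norm_image_sub_le_of_norm_hasDerivWithin_le (f' := fun _ => 0) (C := 0)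
    hf (by simp) hy hx
  simpa [sub_eq_zero] using this

/-- Only the zero solution of `e'' = 2 ε e'` tends to zero at infinity when `Re ε ≥ 0`. -/
theorem eq_zero_of_free_solution {a : ℝ} {ε : ℂ} (hε : 0 ≤ ε.re) {e ed : ℝ → ℂ}
    (he : ∀ x, a ≤ x → HasDerivWithinAt e (ed x) (Ici a) x)
    (hed : ∀ x, a ≤ x → HasDerivWithinAt ed (2 * ε * ed x) (Ici a) x)
    (hlim : Tendsto e atTop (𝓝 0)) {x : ℝ} (hx : a ≤ x) : e x = 0 := by
  have hexp : ∀ x : ℝ, HasDerivAt (fun y : ℝ => Complex.exp (-(2 * ε * y)))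
      (Complex.exp (-(2 * ε * x)) * -(2 * ε)) x := fun x => by
    simpa using (((hasDerivAt_id x).ofReal_comp).const_mul (2 * ε)).neg.cexp
  have hconst : ∀ x, a ≤ x →
      Complex.exp (-(2 * ε * x)) * ed x = Complex.exp (-(2 * ε * a)) * ed a := fun x hx =>
    eqOn_of_hasDerivWithinAt_zero (f := fun y : ℝ => Complex.exp (-(2 * ε * y)) * ed y)
      (fun y hy => ((hexp y).hasDerivWithinAt.fun_mul (hed y hy)).congr_deriv (by ring)) hx le_rfl
  have hedx : ∀ x, a ≤ x → ed x = Complex.exp (2 * ε * (x - a)) * ed a := by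
    intro x hx
    have h := congrArg (Complex.exp (2 * ε * x) * ·) (hconst x hx)
    simp only [← mul_assoc, ← Complex.exp_add] at h
    convert h using 2
    · simp
    · ring_nf
  have hsmall : ∀ δ : ℝ, 0 ≤ δ → e (a + δ) = e a := by
    intro δ hδ
    have hle : ∀ᶠ x in atTop, ‖e (a + δ) - e a‖ ≤ ‖e (x + δ) - e x‖ := by
      filter_upwards [eventually_ge_atTop a] with x hx
      have hshift : ∀ y : ℝ, a ≤ y → ∀ t ∈ Ici (0 : ℝ),
          HasDerivWithinAt (fun t => e (y + t)) (ed (y + t)) (Ici 0) t := by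
        intro y hy t ht
        have ht0 : 0 ≤ t := ht
        have := (he (y + t) (by linarith)).scomp t
          (((hasDerivAt_id t).const_add y).hasDerivWithinAt (s := Ici 0)) fun u hu => by
            have hu0 : 0 ≤ u := hu
            simp only [mem_Ici]
            linarith
        simpa [Function.comp_def] using this
      have key := eqOn_of_hasDerivWithinAt_zero (a := 0)
        (f := fun t => e (x + t) - Complex.exp (2 * ε * (x - a)) * e (a + t))
        (fun t ht => ((hshift x hx t ht).fun_sub ((hshift a le_rfl t ht).const_mul _)).congr_deriv
          (by
            rw [hedx (x + t) (by linarith), hedx (a + t) (by linarith), ← mul_assoc,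
              ← Complex.exp_add]
            push_cast
            ring_nf)) hδ le_rfl
      have hid : e (x + δ) - e x = Complex.exp (2 * ε * (x - a)) * (e (a + δ) - e a) := by
        simp only [add_zero] at key
        linear_combination key
      rw [hid, norm_mul, Complex.norm_exp]
      refine le_mul_of_one_le_left (norm_nonneg _) (Real.one_le_exp ?_)
      have : (2 * ε * ((x : ℂ) - a)).re = 2 * ε.re * (x - a) := by simp
      rw [this]
      exact mul_nonneg (by positivity) (by linarith)
    have hz : Tendsto (fun x => ‖e (x + δ) - e x‖) atTop (𝓝 0) := by
      simpa using ((hlim.comp (tendsto_atTop_add_const_right atTop δ tendsto_id)).sub hlim).norm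
    exact sub_eq_zero.1 (norm_le_zero_iff.1 (ge_of_tendsto hz hle))
  have hval : ∀ y, a ≤ y → e y = e a := fun y hy => by simpa using hsmall (y - a) (by linarith)
  have hea : Tendsto e atTop (𝓝 (e a)) := tendsto_const_nhds.congr'
    ((eventually_ge_atTop a).mono fun y hy => (hval y hy).symm)
  rw [hval x hx, tendsto_nhds_unique hea hlim]

theorem exists_norm_le_of_tendsto_atTop {a : ℝ} {f : ℝ → ℂ} (hf : ContinuousOn f (Ici a))
    (hlim : Tendsto f atTop (𝓝 0)) : ∃ M, 0 ≤ M ∧ ∀ x, a ≤ x → ‖f x‖ ≤ M := by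
  obtain ⟨N, hN⟩ := eventually_atTop.1 (hlim.norm.eventually_le_const (u := 1) (by simp))
  obtain ⟨K, hK⟩ := (isCompact_Icc (a := a) (b := N)).exists_bound_of_continuousOn
    (hf.mono Icc_subset_Ici_self)
  refine ⟨max K 1, by positivity, fun x hx => ?_⟩
  rcases le_total x N with h | h
  · exact (hK x ⟨hx, h⟩).trans (le_max_left _ _)
  · exact (hN x h).trans (le_max_right _ _)

section Volterra

variable {a C : ℝ} {V : ℝ → ℂ} {ε : ℂ}

theorem tendsto_voltOp (ha : 1 ≤ a) (hC : 0 ≤ C) (hV : ∀ x, a ≤ x → ‖V x‖ ≤ C / x ^ 3)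
    (hε : 0 ≤ ε.re) {M : ℝ} (hM0 : 0 ≤ M) {f : ℝ → ℂ} (hM : ∀ x, a ≤ x → ‖f x‖ ≤ M) :
    Tendsto (voltOp V ε f) atTop (𝓝 0) := by
  refine squeeze_zero_norm' ((eventually_ge_atTop a).mono fun x hx => ?_)
    (tendsto_id.const_div_atTop (C * M))
  simpa using norm_voltOp_le ha hC hV hε hM0 (k := 0) (f := f) (by simpa using hM) x hx

theorem eq_zero_of_eq_voltOp (ha : 1 ≤ a) (hC : 0 ≤ C) (hV : ∀ x, a ≤ x → ‖V x‖ ≤ C / x ^ 3)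
    (hε : 0 ≤ ε.re) {M : ℝ} (hM0 : 0 ≤ M) {f : ℝ → ℂ} (hM : ∀ x, a ≤ x → ‖f x‖ ≤ M)
    (hf : ∀ x, a ≤ x → f x = voltOp V ε f x) {x : ℝ} (hx : a ≤ x) : f x = 0 := by
  have hn : ∀ n : ℕ, ∀ x, a ≤ x → ‖f x‖ ≤ M * (C ^ n / n.factorial) / x ^ n := by
    intro n
    induction n with
    | zero => simpa using hM
    | succ n ih =>
      intro x hx
      rw [hf x hx]
      refine (norm_voltOp_le ha hC hV hε (by positivity) ih x hx).trans_eq ?_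
      rw [Nat.factorial_succ]
      push_cast
      field_simp
      ring
  have hn' : ∀ n : ℕ, ‖f x‖ ≤ M * (C ^ n / n.factorial) := fun n => by
    simpa using (hn n x hx).trans
      (div_pow_le_div_pow_of_le (by positivity) (ha.trans hx) n.zero_le)
  have hlim := (Real.summable_pow_div_factorial C).tendsto_atTop_zero.const_mul M
  rw [mul_zero] at hlim
  exact norm_le_zero_iff.1 (ge_of_tendsto' hlim hn')

end Volterra

theorem norm_ofReal_le_div_cube {m : ℕ} (hm : 3 ≤ m) {xP : ℝ} (hxP : 1 < xP)
    {V : ℝ → ℝ} {C₀ : ℝ} (hV : ∀ x, xP ≤ x → |V x| ≤ C₀ / x ^ m) :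
    0 ≤ C₀ ∧ ∀ x, xP ≤ x → ‖(V x : ℂ)‖ ≤ C₀ / x ^ 3 := by
  have hC : 0 ≤ C₀ := by
    have h := (abs_nonneg _).trans (hV xP le_rfl)
    have hp : 0 < xP ^ m := by positivity
    simpa [div_mul_cancel₀ _ hp.ne'] using mul_nonneg h hp.le
  refine ⟨hC, fun x hx => ?_⟩
  rw [Complex.norm_real, Real.norm_eq_abs]
  exact (hV x hx).trans (div_pow_le_div_pow_of_le hC (by linarith) hm)

section Solution

variable {xP C : ℝ} {V : ℝ → ℝ} {ε : ℂ}

theorem solvesS_picardSum_sub_one (ha : 1 ≤ xP) (hC : 0 ≤ C)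
    (hVc : ContinuousOn (fun x => (V x : ℂ)) (Ici xP))
    (hV : ∀ x, xP ≤ x → ‖(V x : ℂ)‖ ≤ C / x ^ 3) (hε : 0 ≤ ε.re) :
    ∃ sd sdd, SolvesS V xP ε (fun x => picardSum (fun x => (V x : ℂ)) ε x - 1) sd sdd := by
  set W : ℝ → ℂ := fun x => (V x : ℂ) with hW
  set w := picardSum W ε with hw
  have hfam := isHolFamily_picardSum ha hC hVc hV
  set M := ∑' n : ℕ, C ^ n / n.factorial with hM
  have hM0 : 0 ≤ M := tsum_nonneg fun n => by positivity
  have hwc : ContinuousOn w (Ici xP) := hfam.continuousOn_right hε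
  have hwM : ∀ x, xP ≤ x → ‖w x‖ ≤ M := by simpa using hfam.norm_le ε hε
  have hfix : ∀ x, xP ≤ x → w x - 1 = voltOp W ε w x := fun x hx => by
    rw [hw, picardSum_eq_one_add_voltOp ha hC hVc hV hε hx, add_sub_cancel_left]
  set p := expTail (2 * ε) (fun t => W t * w t) with hp
  have hpd : ∀ x, xP ≤ x → HasDerivWithinAt p (2 * ε * p x - W x * w x) (Ici xP) x :=
    fun x hx => hasDerivWithinAt_expTail_potential_mul ha hC hVc hV hε hM0 hwc hwM hx
  refine ⟨fun x => -p x, fun x => -(2 * ε * p x - W x * w x), fun x hx => ?_,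
    fun x hx => (hpd x hx).fun_neg, ?_, fun x hx => ?_, ?_⟩
  · exact (hasDerivWithinAt_voltOp ha hC hVc hV hε hM0 hwc hwM hx).congr_of_mem hfix hx
  · have hpc : ContinuousOn p (Ici xP) := fun x hx => (hpd x hx).continuousWithinAt
    exact ((continuousOn_const.mul hpc).sub (hVc.mul hwc)).neg
  · simp only [hW]
    ring
  · exact (tendsto_voltOp ha hC hV hε hM0 hwM).congr'
      ((eventually_ge_atTop xP).mono fun x hx => (hfix x hx).symm)

theorem SolvesS.eqOn (ha : 1 ≤ xP) (hC : 0 ≤ C)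
    (hVc : ContinuousOn (fun x => (V x : ℂ)) (Ici xP))
    (hV : ∀ x, xP ≤ x → ‖(V x : ℂ)‖ ≤ C / x ^ 3) (hε : 0 ≤ ε.re) {g gd gdd s sd sdd : ℝ → ℂ}
    (hg : SolvesS V xP ε g gd gdd) (hs : SolvesS V xP ε s sd sdd) : EqOn g s (Ici xP) := by
  obtain ⟨hg1, hg2, -, hg3, hg4⟩ := hg
  obtain ⟨hs1, hs2, -, hs3, hs4⟩ := hs
  set W : ℝ → ℂ := fun x => (V x : ℂ) with hW
  set d : ℝ → ℂ := fun x => g x - s x with hd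
  have hd1 : ∀ x, xP ≤ x → HasDerivWithinAt d (gd x - sd x) (Ici xP) x := fun x hx =>
    (hg1 x hx).fun_sub (hs1 x hx)
  have hdc : ContinuousOn d (Ici xP) := fun x hx => (hd1 x hx).continuousWithinAt
  have hdlim : Tendsto d atTop (𝓝 0) := by simpa using hg4.sub hs4
  obtain ⟨M, hM0, hM⟩ := exists_norm_le_of_tendsto_atTop hdc hdlim
  have hfix : ∀ x, xP ≤ x → d x = voltOp W ε d x := by
    intro x hx
    refine sub_eq_zero.1 (eq_zero_of_free_solution (e := fun x => d x - voltOp W ε d x) hε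
      (fun y hy => (hd1 y hy).fun_sub (hasDerivWithinAt_voltOp ha hC hVc hV hε hM0 hdc hM hy))
      (fun y hy => (((hg2 y hy).fun_sub (hs2 y hy)).fun_sub
        (hasDerivWithinAt_expTail_potential_mul ha hC hVc hV hε hM0 hdc hM hy).fun_neg).congr_deriv
        ?_) (by simpa using hdlim.sub (tendsto_voltOp ha hC hV hε hM0 hM)) hx)
    simp only [hd, hW]
    linear_combination hg3 y hy - hs3 y hy
  exact fun x hx => sub_eq_zero.1 (eq_zero_of_eq_voltOp ha hC hV hε hM0 hM hfix hx)

end Solution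

/-- existence, uniqueness, analyticity in `ε` on `{Re ε > 0}` and
continuity on `{Re ε ≥ 0}` of the `o(1)` solution of `s'' − 2εs' − Vs = V`. -/
theorem stmt4
    (m : ℕ) (hm : 3 ≤ m) (xP : ℝ) (hxP : 1 < xP)
    (V : ℝ → ℝ) (C₀ : ℝ)
    (hVreg : ContDiffOn ℝ 2 V (Set.Ici xP))
    (hVbd : ∀ k : ℕ, k ≤ 2 → ∀ x : ℝ, xP ≤ x →
      |iteratedDerivWithin k V (Set.Ici xP) x| ≤ C₀ / x ^ (m + k)) :
    ∃ s : ℂ → ℝ → ℂ,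
      (∀ ε : ℂ, 0 ≤ ε.re → ∃ sd sdd : ℝ → ℂ, SolvesS V xP ε (s ε) sd sdd) ∧
      (∀ ε : ℂ, 0 ≤ ε.re → ∀ g gd gdd : ℝ → ℂ, SolvesS V xP ε g gd gdd →
        Set.EqOn g (s ε) (Set.Ici xP)) ∧
      (∀ x : ℝ, xP ≤ x →
        AnalyticOnNhd ℂ (fun ε => s ε x) {ε : ℂ | 0 < ε.re} ∧
        ContinuousOn (fun ε => s ε x) {ε : ℂ | 0 ≤ ε.re}) := by
  have hVc : ContinuousOn (fun x => (V x : ℂ)) (Ici xP) :=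
    Complex.continuous_ofReal.comp_continuousOn hVreg.continuousOn
  obtain ⟨hC, hV⟩ := norm_ofReal_le_div_cube hm hxP
    (fun x hx => by simpa using hVbd 0 (by lia) x hx)
  have hfam := isHolFamily_picardSum hxP.le hC hVc hV
  have hsol := fun (ε : ℂ) (hε : 0 ≤ ε.re) => solvesS_picardSum_sub_one hxP.le hC hVc hV hε
  refine ⟨fun ε x => picardSum (fun x => (V x : ℂ)) ε x - 1, hsol, fun ε hε g gd gdd hg => ?_,
    fun x hx => ⟨?_, (hfam.continuousOn_left hx).sub continuousOn_const⟩⟩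
  · obtain ⟨sd, sdd, hs⟩ := hsol ε hε
    exact hg.eqOn hxP.le hC hVc hV hε hs
  · exact ((hfam.differentiableOn x hx).sub_const 1).analyticOnNhd isOpen_re_pos
end

section
/- Let m ≥ 3 be an integer. Then the differential equation f''(x) = x^{-m} f(x) on (0,∞) has a unique solution Φ₁ with Φ₁(x) → 1 as x → ∞, and it has a solution Φ₂ with Φ₂(x)/x → 1 as x → ∞. -/
open Filter Set Real

/-- `f` (with derivative `fd`) solves `f'' = x^{-m} f` on `(0,∞)`. -/
def SolvesPhi (m : ℕ) (f fd : ℝ → ℝ) : Prop :=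
  ∀ x : ℝ, 0 < x →
    HasDerivAt f (fd x) x ∧ HasDerivAt fd (f x / x ^ m) x

/-- The sum of the power series with coefficients `a`. -/
noncomputable def powSum (a : ℕ → ℝ) (z : ℝ) : ℝ := ∑' k, a k * z ^ k

/-- The coefficients of the formal derivative of a power series. -/
def derivCoeff (a : ℕ → ℝ) (k : ℕ) : ℝ := (k + 1) * a (k + 1)

/-- Coefficients dominated by those of the exponential series. -/
def ExpBounded (a : ℕ → ℝ) : Prop := ∀ k, |a k| ≤ 1 / (k.factorial : ℝ)

lemma ExpBounded.derivCoeff {a : ℕ → ℝ} (ha : ExpBounded a) : ExpBounded (derivCoeff a) := by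
  intro k
  have h := ha (k + 1)
  have hk : (0 : ℝ) < k + 1 := by positivity
  have hf : (0 : ℝ) < k.factorial := by positivity
  rw [_root_.derivCoeff, abs_mul, abs_of_pos hk]
  calc ((k : ℝ) + 1) * |a (k + 1)| ≤ (k + 1) * (1 / ((k + 1).factorial : ℝ)) := by gcongr
    _ = 1 / (k.factorial : ℝ) := by
      rw [Nat.factorial_succ]; push_cast; field_simp

lemma ExpBounded.summable {a : ℕ → ℝ} (ha : ExpBounded a) (z : ℝ) :
    Summable fun k => a k * z ^ k := by
  refine Summable.of_norm_bounded (Real.summable_pow_div_factorial |z|) fun k => ?_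
  rw [norm_mul, norm_pow, Real.norm_eq_abs, Real.norm_eq_abs]
  calc |a k| * |z| ^ k ≤ 1 / (k.factorial : ℝ) * |z| ^ k := by gcongr; exact ha k
    _ = |z| ^ k / k.factorial := by ring

lemma ExpBounded.hasDerivAt {a : ℕ → ℝ} (ha : ExpBounded a) (z : ℝ) :
    HasDerivAt (powSum a) (powSum (_root_.derivCoeff a) z) z := by
  have hu : Summable fun n : ℕ => |a n| * (n * (|z| + 1) ^ (n - 1)) := by
    rw [← summable_nat_add_iff 1]
    refine (ha.derivCoeff.summable (|z| + 1)).abs.congr fun k => ?_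
    rw [_root_.derivCoeff, abs_mul, abs_mul, abs_of_nonneg (by positivity : (0 : ℝ) ≤ k + 1),
      abs_of_nonneg (by positivity : (0 : ℝ) ≤ (|z| + 1) ^ k)]
    push_cast
    ring
  have hz : z ∈ Metric.ball (0 : ℝ) (|z| + 1) := by simp
  have hb : ∀ (n : ℕ) (y : ℝ), y ∈ Metric.ball (0 : ℝ) (|z| + 1) →
      ‖a n * (n * y ^ (n - 1))‖ ≤ |a n| * (n * (|z| + 1) ^ (n - 1)) := by
    intro n y hy
    rw [mem_ball_zero_iff, Real.norm_eq_abs] at hy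
    rw [norm_mul, norm_mul, norm_pow, Real.norm_natCast, Real.norm_eq_abs, Real.norm_eq_abs]
    gcongr
  have key := hasDerivAt_tsum_of_isPreconnected (g := fun n y => a n * y ^ n)
    (g' := fun n y => a n * (n * y ^ (n - 1))) hu Metric.isOpen_ball
    (convex_ball (0 : ℝ) (|z| + 1)).isPreconnected
    (fun n y _ => (hasDerivAt_pow n y).const_mul (a n)) hb hz (ha.summable z) hz
  have hs : Summable fun n : ℕ => a n * (n * z ^ (n - 1)) :=
    Summable.of_norm_bounded hu fun n => hb n z hz
  convert! key using 1
  rw [hs.tsum_eq_zero_add]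
  simp only [powSum, _root_.derivCoeff, CharP.cast_eq_zero, zero_mul, mul_zero, zero_add,
    Nat.add_sub_cancel]
  refine tsum_congr fun k => ?_
  push_cast
  ring

/-- Coefficients of the solution tending to `1` as a power series in `x ^ (-p)`, `p = m - 2`. -/
noncomputable def phiCoeff (p : ℕ) : ℕ → ℝ
  | 0 => 1
  | k + 1 => phiCoeff p k / (p * (k + 1) * (p * (k + 1) + 1))

lemma phiCoeff_pos {p : ℕ} (hp : 1 ≤ p) (k : ℕ) : 0 < phiCoeff p k := by
  induction k with
  | zero => simp [phiCoeff]
  | succ k ih =>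
    have : (0 : ℝ) < p := by exact_mod_cast hp
    rw [phiCoeff]; positivity

lemma expBounded_phiCoeff {p : ℕ} (hp : 1 ≤ p) : ExpBounded (phiCoeff p) := by
  intro k
  rw [abs_of_pos (phiCoeff_pos hp k)]
  induction k with
  | zero => simp [phiCoeff]
  | succ k ih =>
    have hp' : (1 : ℝ) ≤ p := by exact_mod_cast hp
    have hk : (0 : ℝ) < k + 1 := by positivity
    have h1 : (k + 1 : ℝ) ≤ p * (k + 1) := by nlinarith
    rw [phiCoeff, Nat.factorial_succ]
    push_cast
    calc phiCoeff p k / (p * (k + 1) * (p * (k + 1) + 1))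
        ≤ 1 / (k.factorial : ℝ) / (k + 1) := by
          gcongr
          nlinarith
      _ = 1 / ((k + 1) * k.factorial) := by field_simp

lemma powSum_zero (a : ℕ → ℝ) : powSum a 0 = a 0 := by
  rw [powSum, tsum_eq_single 0 (fun k hk => by simp [hk])]
  simp

lemma powSum_phiCoeff_pos {p : ℕ} (hp : 1 ≤ p) {z : ℝ} (hz : 0 ≤ z) :
    0 < powSum (phiCoeff p) z :=
  ((expBounded_phiCoeff hp).summable z).tsum_pos
    (fun k => mul_nonneg (phiCoeff_pos hp k).le (pow_nonneg hz k)) 0 (by simp [phiCoeff])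

lemma powSum_phiCoeff_ode {p : ℕ} (hp : 1 ≤ p) (z : ℝ) :
    p * (p + 1) * powSum (derivCoeff (phiCoeff p)) z +
      p ^ 2 * (z * powSum (derivCoeff (derivCoeff (phiCoeff p))) z) = powSum (phiCoeff p) z := by
  have ha := expBounded_phiCoeff hp
  have hp' : (0 : ℝ) < p := by exact_mod_cast hp
  have h1 := ha.derivCoeff.summable z
  have h2 := (ha.derivCoeff.derivCoeff.summable z).mul_left z
  have e : ∀ k : ℕ, z * (derivCoeff (derivCoeff (phiCoeff p)) k * z ^ k) =
      ((k + 1 : ℕ) : ℝ) * derivCoeff (phiCoeff p) (k + 1) * z ^ (k + 1) := by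
    intro k
    rw [derivCoeff, pow_succ]; push_cast; ring
  have h3 : Summable fun k : ℕ => (k : ℝ) * derivCoeff (phiCoeff p) k * z ^ k := by
    rw [← summable_nat_add_iff 1]
    exact h2.congr e
  have h4 : z * powSum (derivCoeff (derivCoeff (phiCoeff p))) z =
      ∑' k : ℕ, (k : ℝ) * derivCoeff (phiCoeff p) k * z ^ k := by
    rw [powSum, ← tsum_mul_left, h3.tsum_eq_zero_add, tsum_congr e]
    simp
  rw [h4, powSum, powSum, ← tsum_mul_left, ← tsum_mul_left,
    ← (h1.mul_left _).tsum_add (h3.mul_left _)]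
  refine tsum_congr fun k => ?_
  have hk : (0 : ℝ) < k + 1 := by positivity
  rw [derivCoeff, phiCoeff]
  field_simp
  ring

lemma hasDerivAt_inv_pow (n : ℕ) {x : ℝ} (hx : 0 < x) :
    HasDerivAt (fun y : ℝ => (y ^ n)⁻¹) (-n * (x ^ (n + 1))⁻¹) x := by
  have h := hasDerivAt_zpow (-(n : ℤ)) x (Or.inl hx.ne')
  simp only [zpow_neg, zpow_natCast] at h
  convert! h using 1
  rw [show (-(n : ℤ) - 1) = -((n + 1 : ℕ) : ℤ) by push_cast; ring, zpow_neg, zpow_natCast]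
  push_cast
  ring

lemma exists_solvesPhi_tendsto_one {m : ℕ} (hm : 3 ≤ m) :
    ∃ f fd : ℝ → ℝ, SolvesPhi m f fd ∧ (∀ x, 0 < x → 0 < f x) ∧ Tendsto f atTop (nhds 1) := by
  obtain ⟨p, rfl⟩ : ∃ p, m = p + 2 := ⟨m - 2, by omega⟩
  have hp : 1 ≤ p := by omega
  have ha := expBounded_phiCoeff hp
  refine ⟨fun x => powSum (phiCoeff p) (x ^ p)⁻¹,
    fun x => powSum (derivCoeff (phiCoeff p)) (x ^ p)⁻¹ * (-p * (x ^ (p + 1))⁻¹),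
    fun x hx => ⟨(ha.hasDerivAt _).comp x (hasDerivAt_inv_pow p hx), ?_⟩,
    fun x hx => powSum_phiCoeff_pos hp (by positivity), ?_⟩
  · have h := ((ha.derivCoeff.hasDerivAt _).comp x (hasDerivAt_inv_pow p hx)).mul
      ((hasDerivAt_inv_pow (p + 1) hx).const_mul (-(p : ℝ)))
    convert! h using 1
    simp only [Function.comp_apply]
    rw [← powSum_phiCoeff_ode hp]
    push_cast
    field_simp
    ring
  · have h0 : Tendsto (fun x : ℝ => (x ^ p)⁻¹) atTop (nhds 0) :=
      (tendsto_pow_atTop (by omega)).inv_tendsto_atTop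
    have h := (ha.hasDerivAt 0).continuousAt.tendsto.comp h0
    rw [powSum_zero] at h
    exact h

/-- If the derivative of `F` tends to `L` at infinity, then so does `F x / x`. -/
lemma tendsto_div_of_tendsto_deriv {F D : ℝ → ℝ} {L : ℝ} (hF : ∀ x, 0 < x → HasDerivAt F (D x) x)
    (hD : Tendsto D atTop (nhds L)) : Tendsto (fun x => F x / x) atTop (nhds L) := by
  rw [Metric.tendsto_atTop]
  intro ε hε
  obtain ⟨N, hN⟩ := Metric.tendsto_atTop.1 hD (ε / 2) (by positivity)
  set X := max N 1
  have hX : 0 < X := by positivity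
  set K := |F X - L * X|
  refine ⟨max X (2 * K / ε + 1), fun x hx => ?_⟩
  have hxX : X ≤ x := le_trans (le_max_left _ _) hx
  have hxK : 2 * K / ε < x := lt_of_lt_of_le (by linarith) (le_trans (le_max_right _ _) hx)
  have hx0 : 0 < x := hX.trans_le hxX
  have hmv := Convex.norm_image_sub_le_of_norm_hasDerivWithin_le (s := Ici X) (C := ε / 2)
    (f := fun y => F y - L * y) (f' := fun y => D y - L * 1) (x := X) (y := x)
    (fun y hy => ((hF y (hX.trans_le hy)).sub ((hasDerivAt_id y).const_mul L)).hasDerivWithinAt)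
    (fun y hy => by
      have := hN y ((le_max_left _ _).trans hy)
      rw [Real.dist_eq] at this
      rw [Real.norm_eq_abs, mul_one]
      exact this.le)
    (convex_Ici X) self_mem_Ici hxX
  rw [Real.norm_eq_abs, Real.norm_eq_abs, abs_of_nonneg (sub_nonneg.2 hxX)] at hmv
  rw [div_lt_iff₀ hε] at hxK
  have htri : |F x - L * x| ≤ |F x - L * x - (F X - L * X)| + K := by
    simpa using abs_add_le (F x - L * x - (F X - L * X)) (F X - L * X)
  rw [Real.dist_eq, show F x / x - L = (F x - L * x) / x by field_simp, abs_div, abs_of_pos hx0,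
    div_lt_iff₀ hx0]
  nlinarith

lemma exists_hasDerivAt_of_continuousOn_Ioi {D : ℝ → ℝ} (hD : ContinuousOn D (Ioi 0)) :
    ∃ F : ℝ → ℝ, ∀ x, 0 < x → HasDerivAt F (D x) x := by
  refine ⟨fun u => ∫ t in (1 : ℝ)..u, D t, fun x hx => ?_⟩
  refine intervalIntegral.integral_hasDerivAt_right ?_
    (hD.stronglyMeasurableAtFilter isOpen_Ioi x hx) (hD.continuousAt (Ioi_mem_nhds hx))
  refine (hD.mono fun t ht => ?_).intervalIntegrable
  exact lt_of_lt_of_le (lt_min one_pos hx) ht.1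

lemma exists_eq_const_of_hasDerivAt_zero {F : ℝ → ℝ} (hF : ∀ x, 0 < x → HasDerivAt F 0 x) :
    ∃ c, ∀ x, 0 < x → F x = c := by
  obtain ⟨c, hc⟩ := isOpen_Ioi.exists_is_const_of_deriv_eq_zero isPreconnected_Ioi
    (f := F) (s := Ioi (0 : ℝ)) (fun x hx => (hF x hx).differentiableAt.differentiableWithinAt)
    (fun x hx => (hF x hx).deriv)
  exact ⟨c, fun x hx => hc x hx⟩

section ReductionOfOrder

variable {m : ℕ} {f fd I : ℝ → ℝ}

/-- Reduction of order: `f * I` solves the equation when `I' = 1 / f ^ 2`. -/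
lemma SolvesPhi.mul_primitive (hf : SolvesPhi m f fd) (hpos : ∀ x, 0 < x → 0 < f x)
    (hI : ∀ x, 0 < x → HasDerivAt I (1 / f x ^ 2) x) :
    SolvesPhi m (fun x => f x * I x) (fun x => fd x * I x + (f x)⁻¹) := by
  intro x hx
  have hne := (hpos x hx).ne'
  obtain ⟨h1, h2⟩ := hf x hx
  constructor
  · convert! h1.mul (hI x hx) using 1
    field_simp
  · convert! (h2.mul (hI x hx)).add (h1.inv hne) using 1
    field_simp
    ring

/-- The solutions of the equation are spanned by `f` and `f * I`. -/
lemma SolvesPhi.exists_eq_mul (hf : SolvesPhi m f fd) (hpos : ∀ x, 0 < x → 0 < f x)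
    (hI : ∀ x, 0 < x → HasDerivAt I (1 / f x ^ 2) x) {g gd : ℝ → ℝ} (hg : SolvesPhi m g gd) :
    ∃ c K, ∀ x, 0 < x → g x = f x * (c * I x + K) := by
  obtain ⟨c, hc⟩ := exists_eq_const_of_hasDerivAt_zero
    (F := fun x => gd x * f x - g x * fd x) (fun x hx => by
      obtain ⟨h1, h2⟩ := hf x hx
      obtain ⟨h3, h4⟩ := hg x hx
      convert! (h4.mul h1).sub (h3.mul h2) using 1
      ring)
  obtain ⟨K, hK⟩ := exists_eq_const_of_hasDerivAt_zero
    (F := fun x => g x / f x - c * I x) (fun x hx => by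
      convert! ((hg x hx).1.div (hf x hx).1 (hpos x hx).ne').sub ((hI x hx).const_mul c) using 1
      rw [← hc x hx]
      ring)
  refine ⟨c, K, fun x hx => ?_⟩
  have hne := (hpos x hx).ne'
  rw [← hK x hx]
  field_simp
  ring

/-- A solution with the limit `1` is the only one, since the others grow linearly. -/
lemma SolvesPhi.eqOn_of_tendsto_one (hf : SolvesPhi m f fd) (hpos : ∀ x, 0 < x → 0 < f x)
    (hI : ∀ x, 0 < x → HasDerivAt I (1 / f x ^ 2) x) (hflim : Tendsto f atTop (nhds 1))
    (hIlim : Tendsto (fun x => I x / x) atTop (nhds 1)) {g gd : ℝ → ℝ} (hg : SolvesPhi m g gd)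
    (hglim : Tendsto g atTop (nhds 1)) : EqOn g f (Ioi 0) := by
  obtain ⟨c, K, h⟩ := hf.exists_eq_mul hpos hI hg
  have hc : c = 0 := by
    have l1 : Tendsto (fun x => g x / x) atTop (nhds 0) := hglim.div_atTop tendsto_id
    have l2 : Tendsto (fun x => f x * (c * (I x / x) + K / x)) atTop (nhds (1 * (c * 1 + 0))) :=
      hflim.mul ((hIlim.const_mul c).add (tendsto_const_nhds.div_atTop tendsto_id))
    have := tendsto_nhds_unique (l2.congr' ?_) l1
    · simpa using this
    · filter_upwards [eventually_gt_atTop 0] with x hx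
      rw [h x hx]
      ring
  have hK : K = 1 := by
    have l : Tendsto (fun x => f x * K) atTop (nhds (1 * K)) := hflim.mul_const K
    have := tendsto_nhds_unique (l.congr' ?_) hglim
    · simpa using this
    · filter_upwards [eventually_gt_atTop 0] with x hx
      rw [h x hx, hc]
      ring
  intro x hx
  rw [h x hx, hc, hK]
  ring

end ReductionOfOrder

/-- the equation `f'' = x^{-m} f` on `(0,∞)` has a unique solution `Φ₁`
with `Φ₁(x) → 1` as `x → ∞`, and a solution `Φ₂` with `Φ₂(x)/x → 1` as `x → ∞`. -/
theorem stmt9 (m : ℕ) (hm : 3 ≤ m) :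
    (∃ Φ₁ Φ₁d : ℝ → ℝ, SolvesPhi m Φ₁ Φ₁d ∧
      Tendsto Φ₁ atTop (nhds 1) ∧
      (∀ g gd : ℝ → ℝ, SolvesPhi m g gd → Tendsto g atTop (nhds 1) →
        Set.EqOn g Φ₁ (Set.Ioi 0))) ∧
    (∃ Φ₂ Φ₂d : ℝ → ℝ, SolvesPhi m Φ₂ Φ₂d ∧
      Tendsto (fun x => Φ₂ x / x) atTop (nhds 1)) := by
  obtain ⟨f, fd, hf, hpos, hflim⟩ := exists_solvesPhi_tendsto_one hm
  have hcont : ContinuousOn (fun x => 1 / f x ^ 2) (Ioi 0) := fun x hx =>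
    (continuousAt_const.div ((hf x hx).1.continuousAt.pow 2)
      (pow_ne_zero 2 (hpos x hx).ne')).continuousWithinAt
  obtain ⟨I, hI⟩ := exists_hasDerivAt_of_continuousOn_Ioi hcont
  have hIlim : Tendsto (fun x => I x / x) atTop (nhds 1) := by
    refine tendsto_div_of_tendsto_deriv hI ?_
    simpa using (hflim.pow 2).inv₀ (by norm_num)
  refine ⟨⟨f, fd, hf, hflim, fun g gd hg hglim =>
    hf.eqOn_of_tendsto_one hpos hI hflim hIlim hg hglim⟩,
    ⟨_, _, hf.mul_primitive hpos hI, ?_⟩⟩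
  simpa [mul_div_assoc] using hflim.mul hIlim
end

section
/- Let m ≥ 3 be an integer, v₁ ∈ {1, −1}, and ε ∈ ℂ. Let 𝒫 denote the antiderivative operator (𝒫F)(τ) = ∫_0^τ F(u) du. Then the integral equation F(τ) = v₁ ε^{m-1} τ^{m-1}/(m−1)! + v₁ ε^{m-2} (𝒫^m [F(·)/(·(·+2))])(τ) has a unique solution F that is analytic on the half-plane {τ ∈ ℂ : Re τ > −2} and satisfies F(τ) = O(τ^{m-1}) as τ → 0; moreover F(τ) = (v₁ ε^{m-1}/(m−1)!) τ^{m-1} (1 + o(1)) as τ → 0, and for each fixed τ with Re τ > −2 the map ε ↦ F(τ) is entire. -/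
open Filter Set Real Asymptotics

/-- The antiderivative-from-`0` operator `(𝒫F)(τ) = ∫_0^τ F(u) du`, where the
integral is taken along the straight segment from `0` to `τ`. -/
noncomputable def pInt (F : ℂ → ℂ) (τ : ℂ) : ℂ :=
  τ * ∫ u in (0 : ℝ)..1, F ((u : ℂ) * τ)

/-- The half-plane on which the integral equation is posed. -/
def halfPlane : Set ℂ := {τ : ℂ | -2 < τ.re}

/-- Bounded pieces of `halfPlane`, star-shaped about `0`, whose interiors exhaust it. -/
def truncHalfPlane (δ R : ℝ) : Set ℂ := {τ : ℂ | -2 + δ ≤ τ.re ∧ ‖τ‖ ≤ R}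

/-- The operator `F ↦ 𝒫^m [F / (τ (τ + 2))]`. -/
noncomputable def pKernel (m : ℕ) (F : ℂ → ℂ) : ℂ → ℂ :=
  pInt^[m] (fun u => F u / (u * (u + 2)))

lemma isOpen_halfPlane : IsOpen halfPlane := isOpen_lt continuous_const Complex.continuous_re

lemma convex_halfPlane : Convex ℝ halfPlane := convex_halfSpace_re_gt (-2)

lemma zero_mem_halfPlane : (0 : ℂ) ∈ halfPlane := by simp [halfPlane]

lemma halfPlane_mem_nhds_zero : halfPlane ∈ nhds (0 : ℂ) :=
  isOpen_halfPlane.mem_nhds zero_mem_halfPlane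

lemma smul_mem_halfPlane {τ : ℂ} (hτ : τ ∈ halfPlane) {u : ℝ} (hu : u ∈ Icc (0 : ℝ) 1) :
    (u : ℂ) * τ ∈ halfPlane := by
  have := convex_halfPlane.starConvex zero_mem_halfPlane
    |>.smul_mem hτ hu.1 hu.2
  simpa using this

lemma smul_mem_truncHalfPlane {δ R : ℝ} (hδ : δ ≤ 2) {τ : ℂ} (hτ : τ ∈ truncHalfPlane δ R)
    {u : ℝ} (hu : u ∈ Icc (0 : ℝ) 1) : (u : ℂ) * τ ∈ truncHalfPlane δ R := by
  obtain ⟨h1, h2⟩ := hτ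
  obtain ⟨h3, h4⟩ := hu
  refine ⟨?_, ?_⟩
  · rw [Complex.re_ofReal_mul]
    nlinarith
  · rw [norm_mul, Complex.norm_real, Real.norm_of_nonneg h3]
    nlinarith [norm_nonneg τ]

lemma truncHalfPlane_subset {δ R : ℝ} (hδ : 0 < δ) : truncHalfPlane δ R ⊆ halfPlane := by
  intro τ hτ
  have := hτ.1
  change -2 < τ.re
  linarith

lemma isCompact_truncHalfPlane (δ R : ℝ) : IsCompact (truncHalfPlane δ R) := by
  have h : truncHalfPlane δ R = Metric.closedBall 0 R ∩ {τ : ℂ | -2 + δ ≤ τ.re} := by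
    ext τ
    simp [truncHalfPlane, and_comm]
  rw [h]
  exact (isCompact_closedBall _ _).inter_right
    (isClosed_le continuous_const Complex.continuous_re)

lemma truncHalfPlane_mem_nhds {δ R : ℝ} {τ : ℂ} (h1 : -2 + δ < τ.re) (h2 : ‖τ‖ < R) :
    truncHalfPlane δ R ∈ nhds τ := by
  filter_upwards [(isOpen_lt continuous_const Complex.continuous_re).mem_nhds h1,
    (isOpen_lt continuous_norm continuous_const).mem_nhds h2] with z hz1 hz2
  exact ⟨le_of_lt hz1, le_of_lt hz2⟩

lemma exists_truncHalfPlane_mem_nhds {τ : ℂ} (hτ : τ ∈ halfPlane) :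
    ∃ δ R : ℝ, 0 < δ ∧ δ ≤ 1 ∧ 1 < R ∧ truncHalfPlane δ R ∈ nhds τ := by
  have hτ' : -2 < τ.re := hτ
  refine ⟨min 1 ((τ.re + 2) / 2), ‖τ‖ + 2, lt_min one_pos (by linarith), min_le_left _ _,
    by linarith [norm_nonneg τ], truncHalfPlane_mem_nhds ?_ (by linarith)⟩
  linarith [min_le_right 1 ((τ.re + 2) / 2)]

lemma le_norm_add_two {δ R : ℝ} {τ : ℂ} (hτ : τ ∈ truncHalfPlane δ R) : δ ≤ ‖τ + 2‖ := by
  have h := Complex.re_le_norm (τ + 2)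
  have := hτ.1
  simp only [Complex.add_re, Complex.re_ofNat] at h
  linarith

lemma continuousOn_comp_segment {f : ℂ → ℂ} (hf : DifferentiableOn ℂ f halfPlane) {τ : ℂ}
    (hτ : τ ∈ halfPlane) : ContinuousOn (fun u : ℝ => f ((u : ℂ) * τ)) (Icc 0 1) :=
  hf.continuousOn.comp (by fun_prop) fun _ hu => smul_mem_halfPlane hτ hu

lemma intervalIntegrable_comp_segment {f : ℂ → ℂ} (hf : DifferentiableOn ℂ f halfPlane) {τ : ℂ}
    (hτ : τ ∈ halfPlane) :
    IntervalIntegrable (fun u : ℝ => f ((u : ℂ) * τ)) MeasureTheory.volume 0 1 :=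
  ContinuousOn.intervalIntegrable (by
    rw [uIcc_of_le zero_le_one]
    exact continuousOn_comp_segment hf hτ)

lemma differentiableOn_pInt {f : ℂ → ℂ} (hf : DifferentiableOn ℂ f halfPlane) :
    DifferentiableOn ℂ (pInt f) halfPlane := by
  obtain ⟨g, hg⟩ := convex_halfPlane.exists_forall_hasDerivWithinAt hf
  have hg' : ∀ z ∈ halfPlane, HasDerivAt g (f z) z := fun z hz =>
    (hg z hz).hasDerivAt (isOpen_halfPlane.mem_nhds hz)
  have key : ∀ τ ∈ halfPlane, pInt f τ = g τ - g 0 := by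
    intro τ hτ
    have := intervalIntegral.integral_eq_sub_of_hasDerivAt (a := 0) (b := 1)
      (f := fun u : ℝ => g ((u : ℂ) * τ)) (f' := fun u : ℝ => τ * f ((u : ℂ) * τ)) ?_ ?_
    · rw [pInt, ← intervalIntegral.integral_const_mul, this]
      simp
    · intro u hu
      rw [uIcc_of_le zero_le_one] at hu
      have h1 : HasDerivAt (fun u : ℝ => (u : ℂ) * τ) τ u := by
        simpa using (Complex.ofRealCLM.hasDerivAt (x := u)).mul_const τ
      have := (hg' _ (smul_mem_halfPlane hτ hu)).comp u h1
      rwa [mul_comm] at this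
    · exact (intervalIntegrable_comp_segment hf hτ).const_mul τ
  refine DifferentiableOn.congr (f := fun τ => g τ - g 0) ?_ key
  exact fun z hz => ((hg' z hz).differentiableAt.sub_const _).differentiableWithinAt

lemma differentiableOn_pInt_iterate {f : ℂ → ℂ} (hf : DifferentiableOn ℂ f halfPlane) (n : ℕ) :
    DifferentiableOn ℂ (pInt^[n] f) halfPlane := by
  induction n with
  | zero => exact hf
  | succ n ih =>
    rw [Function.iterate_succ_apply']
    exact differentiableOn_pInt ih

lemma differentiableOn_div {f : ℂ → ℂ} (hf : DifferentiableOn ℂ f halfPlane)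
    (hO : f =O[nhds 0] fun τ : ℂ => τ ^ 2) :
    DifferentiableOn ℂ (fun u => f u / (u * (u + 2))) halfPlane := by
  have h0 : f 0 = 0 := by simpa using hO.eq_zero_imp.self_of_nhds
  have h1 : deriv f 0 = 0 := by
    have : HasDerivAt f 0 0 := by
      rw [hasDerivAt_iff_isLittleO]
      simpa [h0] using hO.trans_isLittleO (isLittleO_pow_id one_lt_two)
    exact this.deriv
  have h2 := (Complex.differentiableOn_dslope halfPlane_mem_nhds_zero).2 hf
  have h3 : DifferentiableOn ℂ (fun u => dslope f 0 u / (u + 2)) halfPlane := by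
    refine h2.div (by fun_prop) fun u hu h => ?_
    have hu' : -2 < u.re := hu
    rw [eq_neg_of_add_eq_zero_left h] at hu'
    simp at hu'
  refine h3.congr fun u _ => ?_
  rcases eq_or_ne u 0 with rfl | hu
  · simp [h1]
  · rw [dslope_of_ne _ hu, slope_def_field, h0, sub_zero, sub_zero, div_div]

lemma norm_pInt_le {δ R : ℝ} (hδ : δ ≤ 2) {f : ℂ → ℂ} {C : ℝ} {n : ℕ}
    (hf : ∀ u ∈ truncHalfPlane δ R, ‖f u‖ ≤ C * ‖u‖ ^ n) {τ : ℂ} (hτ : τ ∈ truncHalfPlane δ R) :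
    ‖pInt f τ‖ ≤ C / (n + 1) * ‖τ‖ ^ (n + 1) := by
  have h : ‖∫ u in (0 : ℝ)..1, f ((u : ℂ) * τ)‖ ≤ ∫ u in (0 : ℝ)..1, C * ‖τ‖ ^ n * u ^ n := by
    refine intervalIntegral.norm_integral_le_of_norm_le zero_le_one ?_ ?_
    · refine Eventually.of_forall fun u hu => ?_
      have := hf _ (smul_mem_truncHalfPlane hδ hτ ⟨hu.1.le, hu.2⟩)
      rw [norm_mul, Complex.norm_real, Real.norm_of_nonneg hu.1.le, mul_pow] at this
      linarith
    · exact (by fun_prop : Continuous fun u : ℝ => C * ‖τ‖ ^ n * u ^ n).intervalIntegrable _ _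
  rw [intervalIntegral.integral_const_mul, integral_pow] at h
  rw [pInt, norm_mul]
  refine (mul_le_mul_of_nonneg_left h (norm_nonneg τ)).trans (le_of_eq ?_)
  rw [pow_succ]
  simp
  ring

lemma norm_pInt_iterate_le {δ R : ℝ} (hδ : δ ≤ 2) {f : ℂ → ℂ} {C : ℝ} (hC : 0 ≤ C) {n : ℕ}
    (hf : ∀ u ∈ truncHalfPlane δ R, ‖f u‖ ≤ C * ‖u‖ ^ n) (k : ℕ) {τ : ℂ}
    (hτ : τ ∈ truncHalfPlane δ R) :
    ‖pInt^[k] f τ‖ ≤ C * ‖τ‖ ^ (n + k) := by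
  induction k generalizing τ with
  | zero => exact hf τ hτ
  | succ k ih =>
    rw [Function.iterate_succ_apply']
    refine (norm_pInt_le hδ (fun u hu => ih hu) hτ).trans ?_
    rw [← add_assoc]
    gcongr
    exact div_le_self hC (by push_cast; linarith [(Nat.cast_nonneg (n + k) : (0 : ℝ) ≤ _)])

lemma norm_div_mul_add_two_le {δ R : ℝ} (hδ : 0 < δ) {f : ℂ → ℂ} {C : ℝ} {n : ℕ} {u : ℂ}
    (hC : 0 ≤ C) (hu : u ∈ truncHalfPlane δ R) (hf : ‖f u‖ ≤ C * ‖u‖ ^ (n + 1)) :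
    ‖f u / (u * (u + 2))‖ ≤ C / δ * ‖u‖ ^ n := by
  rcases eq_or_ne u 0 with rfl | hu0
  · simp only [zero_mul, div_zero, norm_zero]
    positivity
  · have hu0' : 0 < ‖u‖ := norm_pos_iff.2 hu0
    rw [norm_div, norm_mul]
    calc ‖f u‖ / (‖u‖ * ‖u + 2‖) ≤ (C * ‖u‖ ^ (n + 1)) / (‖u‖ * δ) := by
          gcongr
          exact le_norm_add_two hu
      _ = C / δ * ‖u‖ ^ n := by
          rw [pow_succ]
          field_simp

lemma norm_pKernel_le {δ R : ℝ} (hδ : 0 < δ) (hδ2 : δ ≤ 2) {m : ℕ} (hm : 3 ≤ m)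
    {f : ℂ → ℂ} {C : ℝ} (hC : 0 ≤ C) (k : ℕ)
    (hf : ∀ u ∈ truncHalfPlane δ R, ‖f u‖ ≤ C * ‖u‖ ^ (m - 1 + k)) {τ : ℂ}
    (hτ : τ ∈ truncHalfPlane δ R) :
    ‖pKernel m f τ‖ ≤ C * (R ^ (m - 2) / δ) / (k + 1) * ‖τ‖ ^ (m - 1 + (k + 1)) := by
  obtain ⟨m, rfl⟩ : ∃ n, m = n + 3 := ⟨m - 3, by omega⟩
  simp only [show m + 3 - 1 = m + 2 by omega, show m + 3 - 2 = m + 1 by omega] at *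
  have h1 : ∀ u ∈ truncHalfPlane δ R,
      ‖f u / (u * (u + 2))‖ ≤ C / δ * ‖u‖ ^ (m + 1 + k) := fun u hu =>
    norm_div_mul_add_two_le hδ hC hu
      (by simpa only [show m + 1 + k + 1 = m + 2 + k by ring] using hf u hu)
  have h2 : ∀ u ∈ truncHalfPlane δ R, ‖pInt (fun u => f u / (u * (u + 2))) u‖ ≤
      C / δ / (k + 1) * ‖u‖ ^ (m + 1 + k + 1) := by
    intro u hu
    refine (norm_pInt_le hδ2 h1 hu).trans ?_
    gcongr
    linarith [(Nat.cast_nonneg m : (0 : ℝ) ≤ m)]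
  have h3 := norm_pInt_iterate_le hδ2 (by positivity) h2 (m + 2) hτ
  rw [pKernel, Function.iterate_succ_apply]
  refine h3.trans ?_
  have hR : ‖τ‖ ^ (m + 1) ≤ R ^ (m + 1) := by
    gcongr
    exact hτ.2
  calc C / δ / (k + 1) * ‖τ‖ ^ (m + 1 + k + 1 + (m + 2))
      = C / δ / (k + 1) * ‖τ‖ ^ (m + 1) * ‖τ‖ ^ (m + 2 + (k + 1)) := by ring
    _ ≤ C / δ / (k + 1) * R ^ (m + 1) * ‖τ‖ ^ (m + 2 + (k + 1)) := by gcongr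
    _ = _ := by ring

lemma hasSum_pInt {δ R : ℝ} (hδ : 0 < δ) (hδ2 : δ ≤ 2) {f : ℕ → ℂ → ℂ} {g : ℂ → ℂ} {a : ℕ → ℝ}
    (ha : Summable a) (hf : ∀ k, DifferentiableOn ℂ (f k) halfPlane)
    (hfa : ∀ k, ∀ u ∈ truncHalfPlane δ R, ‖f k u‖ ≤ a k)
    (hs : ∀ u ∈ truncHalfPlane δ R, HasSum (fun k => f k u) (g u)) {τ : ℂ}
    (hτ : τ ∈ truncHalfPlane δ R) : HasSum (fun k => pInt (f k) τ) (pInt g τ) := by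
  refine HasSum.mul_left τ ?_
  refine intervalIntegral.hasSum_integral_of_dominated_convergence (fun k _ => a k) ?_ ?_ ?_ ?_ ?_
  · intro k
    exact (intervalIntegrable_comp_segment (hf k) (truncHalfPlane_subset hδ hτ)).def'.1
  · refine fun k => Eventually.of_forall fun u hu => ?_
    rw [uIoc_of_le zero_le_one] at hu
    exact hfa k _ (smul_mem_truncHalfPlane hδ2 hτ ⟨hu.1.le, hu.2⟩)
  · exact Eventually.of_forall fun _ _ => ha
  · exact intervalIntegrable_const
  · refine Eventually.of_forall fun u hu => ?_
    rw [uIoc_of_le zero_le_one] at hu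
    exact hs _ (smul_mem_truncHalfPlane hδ2 hτ ⟨hu.1.le, hu.2⟩)

lemma hasSum_pInt_iterate {δ R : ℝ} (hδ : 0 < δ) (hδ2 : δ ≤ 2) {f : ℕ → ℂ → ℂ} {g : ℂ → ℂ}
    {a : ℕ → ℝ} (ha0 : ∀ k, 0 ≤ a k)
    (ha : Summable a) (hf : ∀ k, DifferentiableOn ℂ (f k) halfPlane)
    (hfa : ∀ k, ∀ u ∈ truncHalfPlane δ R, ‖f k u‖ ≤ a k)
    (hs : ∀ u ∈ truncHalfPlane δ R, HasSum (fun k => f k u) (g u)) (n : ℕ) {τ : ℂ}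
    (hτ : τ ∈ truncHalfPlane δ R) : HasSum (fun k => pInt^[n] (f k) τ) (pInt^[n] g τ) := by
  induction n generalizing τ with
  | zero => exact hs τ hτ
  | succ n ih =>
    simp only [Function.iterate_succ_apply']
    refine hasSum_pInt hδ hδ2 (ha.mul_right (R ^ n))
      (fun k => differentiableOn_pInt_iterate (hf k) n) (fun k u hu => ?_)
      (fun u hu => ih hu) hτ
    have := norm_pInt_iterate_le hδ2 (ha0 k) (n := 0) (by simpa using hfa k) n hu
    rw [zero_add] at this
    refine this.trans ?_
    have := ha0 k
    gcongr
    exact hu.2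

lemma pInt_iterate_sub {f g : ℂ → ℂ} (hf : DifferentiableOn ℂ f halfPlane)
    (hg : DifferentiableOn ℂ g halfPlane) (n : ℕ) {τ : ℂ} (hτ : τ ∈ halfPlane) :
    pInt^[n] (fun u => f u - g u) τ = pInt^[n] f τ - pInt^[n] g τ := by
  induction n generalizing τ with
  | zero => rfl
  | succ n ih =>
    simp only [Function.iterate_succ_apply']
    have h : pInt (pInt^[n] fun u => f u - g u) τ =
        pInt (fun u => pInt^[n] f u - pInt^[n] g u) τ := by
      unfold pInt
      congr 1
      refine intervalIntegral.integral_congr fun u hu => ?_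
      rw [uIcc_of_le zero_le_one] at hu
      exact ih (smul_mem_halfPlane hτ hu)
    rw [h]
    simp only [pInt]
    rw [intervalIntegral.integral_sub
      (intervalIntegrable_comp_segment (differentiableOn_pInt_iterate hf n) hτ)
      (intervalIntegrable_comp_segment (differentiableOn_pInt_iterate hg n) hτ), mul_sub]

lemma pInt_const_mul (c : ℂ) (f : ℂ → ℂ) :
    pInt (fun u => c * f u) = fun u => c * pInt f u := by
  funext τ
  simp only [pInt, intervalIntegral.integral_const_mul]
  ring

lemma pInt_iterate_const_mul (c : ℂ) (f : ℂ → ℂ) (n : ℕ) :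
    pInt^[n] (fun u => c * f u) = fun u => c * pInt^[n] f u := by
  induction n with
  | zero => rfl
  | succ n ih => simp only [Function.iterate_succ_apply', ih, pInt_const_mul]

lemma pKernel_const_mul (m : ℕ) (c : ℂ) (f : ℂ → ℂ) :
    pKernel m (fun u => c * f u) = fun u => c * pKernel m f u := by
  simp only [pKernel, mul_div_assoc, pInt_iterate_const_mul]

lemma differentiableOn_pKernel {f : ℂ → ℂ} (hf : DifferentiableOn ℂ f halfPlane)
    (hO : f =O[nhds 0] fun τ : ℂ => τ ^ 2) (m : ℕ) :
    DifferentiableOn ℂ (pKernel m f) halfPlane :=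
  differentiableOn_pInt_iterate (differentiableOn_div hf hO) m

lemma pKernel_sub {f g : ℂ → ℂ} (hf : DifferentiableOn ℂ f halfPlane)
    (hfO : f =O[nhds 0] fun τ : ℂ => τ ^ 2) (hg : DifferentiableOn ℂ g halfPlane)
    (hgO : g =O[nhds 0] fun τ : ℂ => τ ^ 2) (m : ℕ) {τ : ℂ} (hτ : τ ∈ halfPlane) :
    pKernel m (fun u => f u - g u) τ = pKernel m f τ - pKernel m g τ := by
  simp only [pKernel, sub_div]
  exact pInt_iterate_sub (differentiableOn_div hf hfO) (differentiableOn_div hg hgO) m hτ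

/-- The iterates of `pKernel m` on the monomial `τ ^ (m - 1) / (m - 1)!`. -/
noncomputable def pTerm (m k : ℕ) : ℂ → ℂ :=
  (pKernel m)^[k] fun τ => τ ^ (m - 1) / (Nat.factorial (m - 1) : ℂ)

/-- The Neumann series solving `f = τ ^ (m - 1) / (m - 1)! + c 𝒫^m [f / (τ (τ + 2))]`. -/
noncomputable def neumannSol (m : ℕ) (c τ : ℂ) : ℂ := ∑' k, c ^ k * pTerm m k τ

lemma pTerm_succ (m k : ℕ) : pTerm m (k + 1) = pKernel m (pTerm m k) :=
  Function.iterate_succ_apply' _ _ _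

lemma norm_pTerm_le {δ R : ℝ} (hδ : 0 < δ) (hδ2 : δ ≤ 2) (hR : 0 ≤ R) {m : ℕ} (hm : 3 ≤ m)
    (k : ℕ) {τ : ℂ} (hτ : τ ∈ truncHalfPlane δ R) :
    ‖pTerm m k τ‖ ≤ (R ^ (m - 2) / δ) ^ k / Nat.factorial k * ‖τ‖ ^ (m - 1 + k) := by
  induction k generalizing τ with
  | zero =>
    simp only [pTerm, Function.iterate_zero, id, norm_div, norm_pow, Complex.norm_natCast, pow_zero,
      Nat.factorial_zero, Nat.cast_one, div_one, one_mul, add_zero]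
    exact div_le_self (by positivity) (by exact_mod_cast Nat.one_le_of_lt (Nat.factorial_pos _))
  | succ k ih =>
    rw [pTerm_succ]
    refine (norm_pKernel_le hδ hδ2 hm (by positivity) k (fun u hu => ih hu) hτ).trans (le_of_eq ?_)
    rw [Nat.factorial_succ, pow_succ]
    push_cast
    field_simp

lemma norm_term_le {δ R : ℝ} (hδ : 0 < δ) (hδ2 : δ ≤ 2) (hR : 0 ≤ R) {m : ℕ} (hm : 3 ≤ m)
    {c : ℂ} {r : ℝ} (hc : ‖c‖ ≤ r) (k : ℕ) {τ : ℂ} (hτ : τ ∈ truncHalfPlane δ R) :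
    ‖c ^ k * pTerm m k τ‖ ≤
      (r * (R ^ (m - 2) / δ) * R) ^ k / Nat.factorial k * ‖τ‖ ^ (m - 1) := by
  rw [norm_mul, norm_pow]
  have hr : 0 ≤ r := (norm_nonneg c).trans hc
  have hτR : ‖τ‖ ≤ R := hτ.2
  calc ‖c‖ ^ k * ‖pTerm m k τ‖
      ≤ r ^ k * ((R ^ (m - 2) / δ) ^ k / Nat.factorial k * (‖τ‖ ^ (m - 1) * R ^ k)) := by
        gcongr
        refine (norm_pTerm_le hδ hδ2 hR hm k hτ).trans ?_
        rw [pow_add]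
        gcongr
    _ = _ := by
        rw [mul_pow, mul_pow]
        ring

lemma isBigO_pow_of_bound {δ R : ℝ} (hδ : δ ≤ 1) (hR : 1 ≤ R) {f : ℂ → ℂ} {C : ℝ} {n p : ℕ}
    (hnp : p ≤ n) (hf : ∀ u ∈ truncHalfPlane δ R, ‖f u‖ ≤ C * ‖u‖ ^ n) :
    f =O[nhds 0] fun τ : ℂ => τ ^ p := by
  have h : f =O[nhds 0] fun τ : ℂ => τ ^ n := by
    refine IsBigO.of_bound C ?_
    have : truncHalfPlane δ R ∈ nhds (0 : ℂ) :=
      truncHalfPlane_mem_nhds (by simp; linarith) (by simp; linarith)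
    filter_upwards [this] with u hu
    rw [norm_pow]
    exact hf u hu
  refine h.trans ?_
  rw [← Nat.sub_add_cancel hnp]
  simp only [pow_add]
  have h1 : (fun τ : ℂ => τ ^ (n - p)) =O[nhds 0] fun _ => (1 : ℂ) :=
    (continuous_pow (n - p)).continuousAt.isBigO_one ℂ
  simpa using h1.mul (isBigO_refl (fun τ : ℂ => τ ^ p) (nhds 0))

lemma pTerm_isBigO {m : ℕ} (hm : 3 ≤ m) (k : ℕ) :
    pTerm m k =O[nhds 0] fun τ : ℂ => τ ^ 2 :=
  isBigO_pow_of_bound (δ := 1) (R := 1) (n := m - 1 + k) le_rfl le_rfl (by omega) fun _ hu =>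
    norm_pTerm_le one_pos one_le_two zero_le_one hm k hu

lemma differentiableOn_pTerm {m : ℕ} (hm : 3 ≤ m) (k : ℕ) :
    DifferentiableOn ℂ (pTerm m k) halfPlane := by
  induction k with
  | zero =>
    simp only [pTerm, Function.iterate_zero, id]
    fun_prop
  | succ k ih =>
    rw [pTerm_succ]
    exact differentiableOn_pKernel ih (pTerm_isBigO hm k) m

lemma hasSum_neumannSol {m : ℕ} (hm : 3 ≤ m) (c : ℂ) {τ : ℂ} (hτ : τ ∈ halfPlane) :
    HasSum (fun k => c ^ k * pTerm m k τ) (neumannSol m c τ) := by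
  obtain ⟨δ, R, hδ, hδ1, hR, hS⟩ := exists_truncHalfPlane_mem_nhds hτ
  exact (Summable.of_norm_bounded ((Real.summable_pow_div_factorial _).mul_right _) fun k =>
    norm_term_le hδ (by linarith) (by linarith) hm le_rfl k (mem_of_mem_nhds hS)).hasSum

lemma exists_norm_neumannSol_le {δ R : ℝ} (hδ : 0 < δ) (hδ2 : δ ≤ 2) (hR : 0 ≤ R) {m : ℕ}
    (hm : 3 ≤ m) (c : ℂ) : ∃ C : ℝ, 0 ≤ C ∧
      ∀ τ ∈ truncHalfPlane δ R, ‖neumannSol m c τ‖ ≤ C * ‖τ‖ ^ (m - 1) := by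
  refine ⟨∑' k : ℕ, (‖c‖ * (R ^ (m - 2) / δ) * R) ^ k / Nat.factorial k,
    tsum_nonneg fun k => by positivity, fun τ hτ => ?_⟩
  rw [← tsum_mul_right]
  exact tsum_of_norm_bounded ((Real.summable_pow_div_factorial _).mul_right _).hasSum fun k =>
    norm_term_le hδ hδ2 hR hm le_rfl k hτ

lemma neumannSol_isBigO {m : ℕ} (hm : 3 ≤ m) (c : ℂ) {p : ℕ} (hp : p ≤ m - 1) :
    neumannSol m c =O[nhds 0] fun τ : ℂ => τ ^ p := by
  obtain ⟨C, -, hC⟩ := exists_norm_neumannSol_le (δ := 1) (R := 1) one_pos one_le_two zero_le_one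
    hm c
  exact isBigO_pow_of_bound le_rfl le_rfl hp hC

lemma differentiableOn_neumannSol {m : ℕ} (hm : 3 ≤ m) (c : ℂ) :
    DifferentiableOn ℂ (neumannSol m c) halfPlane := by
  intro τ hτ
  obtain ⟨δ, R, hδ, hδ1, hR, hS⟩ := exists_truncHalfPlane_mem_nhds hτ
  have hR0 : 0 ≤ R := by linarith
  have h : DifferentiableOn ℂ (neumannSol m c) (interior (truncHalfPlane δ R)) := by
    refine Complex.differentiableOn_tsum_of_summable_norm
      ((Real.summable_pow_div_factorial (‖c‖ * (R ^ (m - 2) / δ) * R)).mul_right (R ^ (m - 1)))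
      (fun k => ?_) isOpen_interior fun k w hw => ?_
    · exact ((differentiableOn_pTerm hm k).const_mul _).mono
        (interior_subset.trans (truncHalfPlane_subset hδ))
    · refine (norm_term_le hδ (by linarith) hR0 hm le_rfl k (interior_subset hw)).trans ?_
      gcongr
      exact (interior_subset hw).2
  exact (h.differentiableAt (isOpen_interior.mem_nhds (mem_interior_iff_mem_nhds.2 hS)))
    |>.differentiableWithinAt

lemma differentiable_neumannSol_param {m : ℕ} (hm : 3 ≤ m) {τ : ℂ} (hτ : τ ∈ halfPlane) :
    Differentiable ℂ fun c => neumannSol m c τ := by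
  intro c
  obtain ⟨δ, R, hδ, hδ1, hR, hS⟩ := exists_truncHalfPlane_mem_nhds hτ
  have h : DifferentiableOn ℂ (fun c => neumannSol m c τ) (Metric.ball 0 (‖c‖ + 1)) := by
    refine Complex.differentiableOn_tsum_of_summable_norm
      ((Real.summable_pow_div_factorial ((‖c‖ + 1) * (R ^ (m - 2) / δ) * R)).mul_right
        (‖τ‖ ^ (m - 1)))
      (fun k => by fun_prop) Metric.isOpen_ball fun k w hw => ?_
    exact norm_term_le hδ (by linarith) (by linarith) hm (mem_ball_zero_iff.1 hw).le k
      (mem_of_mem_nhds hS)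
  exact h.differentiableAt (Metric.isOpen_ball.mem_nhds (by simp))

lemma neumannSol_eq {m : ℕ} (hm : 3 ≤ m) (c : ℂ) {τ : ℂ} (hτ : τ ∈ halfPlane) :
    neumannSol m c τ = τ ^ (m - 1) / (Nat.factorial (m - 1) : ℂ) +
      c * pKernel m (neumannSol m c) τ := by
  obtain ⟨δ, R, hδ, hδ1, hR, hS⟩ := exists_truncHalfPlane_mem_nhds hτ
  have hR0 : 0 ≤ R := by linarith
  have hδ2 : δ ≤ 2 := by linarith
  set A : ℝ := ‖c‖ * (R ^ (m - 2) / δ) * R with hA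
  have hA0 : 0 ≤ A := by positivity
  have hK : HasSum (fun k => pKernel m (fun u => c ^ k * pTerm m k u) τ)
      (pKernel m (neumannSol m c) τ) := by
    refine hasSum_pInt_iterate (a := fun k => A ^ k / Nat.factorial k * (R ^ (m - 2) / δ)) hδ hδ2
      (fun k => by positivity) ((Real.summable_pow_div_factorial A).mul_right _) (fun k => ?_)
      (fun k u hu => ?_) (fun u hu => ?_) m (mem_of_mem_nhds hS)
    · exact differentiableOn_div ((differentiableOn_pTerm hm k).const_mul _)
        ((pTerm_isBigO hm k).const_mul_left _)
    · have h1 := norm_term_le hδ hδ2 hR0 hm (le_refl ‖c‖) k hu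
      rw [show m - 1 = m - 2 + 1 by omega] at h1
      refine (norm_div_mul_add_two_le (f := fun u => c ^ k * pTerm m k u) hδ (by positivity) hu
        h1).trans ?_
      rw [div_mul_eq_mul_div, mul_div_assoc]
      gcongr
      exact hu.2
    · exact (hasSum_neumannSol hm c (truncHalfPlane_subset hδ hu)).div_const _
  have h1 := hasSum_neumannSol hm c hτ
  rw [← hasSum_nat_add_iff' 1] at h1
  have h2 := hK.mul_left c
  have h3 : (fun k => c * pKernel m (fun u => c ^ k * pTerm m k u) τ) =
      fun k => c ^ (k + 1) * pTerm m (k + 1) τ := by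
    funext k
    rw [pKernel_const_mul, pTerm_succ]
    ring
  rw [h3] at h2
  have h4 := h1.unique h2
  rw [← h4]
  simp [pTerm]

lemma exists_bound_of_isBigO {f : ℂ → ℂ} {n : ℕ} (hf : DifferentiableOn ℂ f halfPlane)
    (hO : f =O[nhds 0] fun τ : ℂ => τ ^ n) {δ R : ℝ} (hδ : 0 < δ) :
    ∃ C : ℝ, 0 ≤ C ∧ ∀ τ ∈ truncHalfPlane δ R, ‖f τ‖ ≤ C * ‖τ‖ ^ n := by
  obtain ⟨C, hC, hCO⟩ := hO.exists_pos
  obtain ⟨ρ, hρ, hball⟩ := Metric.eventually_nhds_iff.1 hCO.bound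
  obtain ⟨M, hM⟩ := (isCompact_truncHalfPlane δ R).exists_bound_of_continuousOn
    (hf.continuousOn.mono (truncHalfPlane_subset hδ))
  refine ⟨max C (M / ρ ^ n), le_max_of_le_left hC.le, fun τ hτ => ?_⟩
  rcases lt_or_ge ‖τ‖ ρ with h | h
  · have := hball (y := τ) (by simpa using h)
    rw [norm_pow] at this
    exact this.trans (by gcongr; exact le_max_left _ _)
  · have hM0 : 0 ≤ M := (norm_nonneg _).trans (hM τ hτ)
    calc ‖f τ‖ ≤ M := hM τ hτ
      _ = M / ρ ^ n * ρ ^ n := by field_simp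
      _ ≤ max C (M / ρ ^ n) * ‖τ‖ ^ n := by
        gcongr
        exact le_max_right _ _

lemma eq_zero_of_eq_const_mul_pKernel {m : ℕ} (hm : 3 ≤ m) (c : ℂ) {D : ℂ → ℂ}
    (hD : DifferentiableOn ℂ D halfPlane) (hO : D =O[nhds 0] fun τ : ℂ => τ ^ (m - 1))
    (h : ∀ τ ∈ halfPlane, D τ = c * pKernel m D τ) {τ : ℂ} (hτ : τ ∈ halfPlane) : D τ = 0 := by
  obtain ⟨δ, R, hδ, hδ1, hR, hS⟩ := exists_truncHalfPlane_mem_nhds hτ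
  have hR0 : 0 ≤ R := by linarith
  obtain ⟨C, hC, hCD⟩ := exists_bound_of_isBigO hD hO (R := R) hδ
  have key : ∀ k : ℕ, ∀ u ∈ truncHalfPlane δ R,
      ‖D u‖ ≤ C * ((‖c‖ * (R ^ (m - 2) / δ)) ^ k / Nat.factorial k) * ‖u‖ ^ (m - 1 + k) := by
    intro k
    induction k with
    | zero => simpa using hCD
    | succ k ih =>
      intro u hu
      rw [h u (truncHalfPlane_subset hδ hu), norm_mul]
      refine (mul_le_mul_of_nonneg_left (norm_pKernel_le hδ (by linarith) hm (by positivity) k ih hu)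
        (norm_nonneg c)).trans (le_of_eq ?_)
      rw [Nat.factorial_succ, pow_succ]
      push_cast
      field_simp
  have hlim : Tendsto (fun k : ℕ => C * ((‖c‖ * (R ^ (m - 2) / δ) * ‖τ‖) ^ k / Nat.factorial k)
      * ‖τ‖ ^ (m - 1)) atTop (nhds (C * 0 * ‖τ‖ ^ (m - 1))) :=
    ((FloorSemiring.tendsto_pow_div_factorial_atTop _).const_mul C).mul_const _
  rw [mul_zero, zero_mul] at hlim
  refine norm_le_zero_iff.1 (ge_of_tendsto' hlim fun k => ?_)
  refine (key k τ (mem_of_mem_nhds hS)).trans (le_of_eq ?_)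
  rw [pow_add, mul_pow _ ‖τ‖]
  ring

/-- the integral equation
`F(τ) = v₁ ε^{m-1} τ^{m-1}/(m−1)! + v₁ ε^{m-2} 𝒫^m[F/(τ(τ+2))](τ)`
has a unique solution analytic on `{Re τ > −2}` with `F(τ) = O(τ^{m-1})` at `0`;
moreover `F(τ) = (v₁ ε^{m-1}/(m−1)!) τ^{m-1}(1 + o(1))` as `τ → 0`, and for each
fixed `τ` the solution is entire in `ε`. -/
theorem stmt12
    (m : ℕ) (hm : 3 ≤ m) (v₁ : ℂ) (hv : v₁ = 1 ∨ v₁ = -1) :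
    ∃ F : ℂ → ℂ → ℂ,
      (∀ ε : ℂ,
        AnalyticOnNhd ℂ (F ε) {τ : ℂ | -2 < τ.re} ∧
        (∀ τ : ℂ, -2 < τ.re →
          F ε τ = v₁ * ε ^ (m - 1) * τ ^ (m - 1) / (Nat.factorial (m - 1) : ℂ)
            + v₁ * ε ^ (m - 2) *
              (pInt^[m] (fun u => F ε u / (u * (u + 2)))) τ) ∧
        (F ε) =O[nhds 0] (fun τ : ℂ => τ ^ (m - 1)) ∧
        (fun τ : ℂ =>
            F ε τ - v₁ * ε ^ (m - 1) / (Nat.factorial (m - 1) : ℂ) * τ ^ (m - 1))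
          =o[nhds 0] (fun τ : ℂ => τ ^ (m - 1))) ∧
      -- uniqueness
      (∀ ε : ℂ, ∀ G : ℂ → ℂ,
        AnalyticOnNhd ℂ G {τ : ℂ | -2 < τ.re} →
        (∀ τ : ℂ, -2 < τ.re →
          G τ = v₁ * ε ^ (m - 1) * τ ^ (m - 1) / (Nat.factorial (m - 1) : ℂ)
            + v₁ * ε ^ (m - 2) *
              (pInt^[m] (fun u => G u / (u * (u + 2)))) τ) →
        G =O[nhds 0] (fun τ : ℂ => τ ^ (m - 1)) →
        ∀ τ : ℂ, -2 < τ.re → G τ = F ε τ) ∧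
      -- entirety in ε
      (∀ τ : ℂ, -2 < τ.re →
        AnalyticOnNhd ℂ (fun ε => F ε τ) Set.univ) := by
  have hsol : ∀ ε : ℂ, DifferentiableOn ℂ
      (fun τ => v₁ * ε ^ (m - 1) * neumannSol m (v₁ * ε ^ (m - 2)) τ) halfPlane := fun ε =>
    (differentiableOn_neumannSol hm _).const_mul _
  have hbigO : ∀ ε : ℂ, ∀ p ≤ m - 1, (fun τ => v₁ * ε ^ (m - 1) *
      neumannSol m (v₁ * ε ^ (m - 2)) τ) =O[nhds 0] fun τ : ℂ => τ ^ p := fun ε p hp =>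
    (neumannSol_isBigO hm _ hp).const_mul_left _
  have heq : ∀ ε : ℂ, ∀ τ ∈ halfPlane, v₁ * ε ^ (m - 1) * neumannSol m (v₁ * ε ^ (m - 2)) τ =
      v₁ * ε ^ (m - 1) * τ ^ (m - 1) / (Nat.factorial (m - 1) : ℂ) + v₁ * ε ^ (m - 2) *
        pKernel m (fun u => v₁ * ε ^ (m - 1) * neumannSol m (v₁ * ε ^ (m - 2)) u) τ := by
    intro ε τ hτ
    rw [pKernel_const_mul, neumannSol_eq hm _ hτ]
    ring
  refine ⟨fun ε τ => v₁ * ε ^ (m - 1) * neumannSol m (v₁ * ε ^ (m - 2)) τ,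
    fun ε => ⟨(hsol ε).analyticOnNhd isOpen_halfPlane, heq ε, hbigO ε _ le_rfl, ?_⟩, ?_, ?_⟩
  · obtain ⟨C, hC, hCF⟩ := exists_norm_neumannSol_le (δ := 1) (R := 1) one_pos one_le_two
      zero_le_one hm (v₁ * ε ^ (m - 2))
    have hK := isBigO_pow_of_bound (p := m) le_rfl le_rfl (by omega) fun u hu =>
      norm_pKernel_le one_pos one_le_two hm hC 0 hCF hu
    refine IsLittleO.congr' (((hK.trans_isLittleO (isLittleO_pow_pow (by omega : m - 1 < m)))
      |>.const_mul_left (v₁ * ε ^ (m - 1) * (v₁ * ε ^ (m - 2))))) ?_ EventuallyEq.rfl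
    filter_upwards [halfPlane_mem_nhds_zero] with τ hτ
    rw [neumannSol_eq hm _ hτ]
    ring
  · intro ε G hG hGeq hGO τ hτ
    have hGd : DifferentiableOn ℂ G halfPlane := hG.differentiableOn
    have hG2 : G =O[nhds 0] fun τ : ℂ => τ ^ 2 := by
      obtain ⟨C, -, hC⟩ := exists_bound_of_isBigO hGd hGO (R := 1) one_pos
      exact isBigO_pow_of_bound le_rfl le_rfl (by omega) hC
    refine sub_eq_zero.1 (eq_zero_of_eq_const_mul_pKernel hm (v₁ * ε ^ (m - 2))
      (D := fun τ => G τ - v₁ * ε ^ (m - 1) * neumannSol m (v₁ * ε ^ (m - 2)) τ)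
      (hGd.sub (hsol ε)) (hGO.sub (hbigO ε _ le_rfl)) (fun z hz => ?_) hτ)
    have hGz : G z = v₁ * ε ^ (m - 1) * z ^ (m - 1) / (Nat.factorial (m - 1) : ℂ) +
      v₁ * ε ^ (m - 2) * pKernel m G z := hGeq z hz
    rw [pKernel_sub hGd hG2 (hsol ε) (hbigO ε 2 (by omega)) m hz, mul_sub]
    linear_combination hGz - heq ε z hz
  · intro τ hτ
    have h : Differentiable ℂ fun ε : ℂ =>
        v₁ * ε ^ (m - 1) * neumannSol m (v₁ * ε ^ (m - 2)) τ :=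
      Differentiable.mul (by fun_prop) ((differentiable_neumannSol_param hm hτ).comp
        (g := fun c => neumannSol m c τ) (f := fun ε : ℂ => v₁ * ε ^ (m - 2)) (by fun_prop))
    exact fun ε _ => h.analyticAt ε
end

section
/- Let a > 0 be a real number. Then there exist constants c > 0 and C > 0 such that (j!)^a ≥ C c^j Γ(a j + 1) for all nonnegative integers j, where Γ is the Gamma function. -/
open Real

lemma rpow_mul_nat_le_factorial_rpow_mul_exp {a t : ℝ} (ha : 0 < a) (ht : 0 ≤ t) (j : ℕ) :
    t ^ (a * j) ≤ (Nat.factorial j : ℝ) ^ a * ((2 * a) ^ a) ^ j * exp (t / 2) := by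
  have h : t ^ j ≤ (Nat.factorial j : ℝ) * (2 * a) ^ j * exp (t / (2 * a)) := by
    have h₁ := pow_div_factorial_le_exp (x := t / (2 * a)) (by positivity) j
    rw [div_le_iff₀ (by positivity), div_pow, div_le_iff₀ (by positivity)] at h₁
    linarith
  calc t ^ (a * j) = (t ^ j) ^ a := by
        rw [mul_comm, rpow_mul ht, rpow_natCast]
    _ ≤ ((Nat.factorial j : ℝ) * (2 * a) ^ j * exp (t / (2 * a))) ^ a :=
        rpow_le_rpow (by positivity) h ha.le
    _ = (Nat.factorial j : ℝ) ^ a * ((2 * a) ^ a) ^ j * exp (t / 2) := by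
        rw [mul_rpow (by positivity) (by positivity), mul_rpow (by positivity) (by positivity),
          ← exp_mul, ← rpow_natCast, ← rpow_natCast, ← rpow_mul (by positivity),
          ← rpow_mul (by positivity), mul_comm a (j : ℝ)]
        congr 2
        field_simp

lemma Gamma_mul_nat_add_one_le {a : ℝ} (ha : 0 < a) (j : ℕ) :
    Real.Gamma (a * j + 1) ≤ 2 * ((Nat.factorial j : ℝ) ^ a * ((2 * a) ^ a) ^ j) := by
  have hint : MeasureTheory.IntegrableOn (fun t : ℝ ↦ exp (-(1 / 2) * t)) (Set.Ioi 0) :=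
    integrableOn_exp_mul_Ioi (by norm_num) 0
  have hGamma := GammaIntegral_convergent (s := a * j + 1) (by positivity)
  rw [Gamma_eq_integral (by positivity)]
  calc _ ≤ ∫ t in Set.Ioi (0 : ℝ),
        (Nat.factorial j : ℝ) ^ a * ((2 * a) ^ a) ^ j * exp (-(1 / 2) * t) := by
        refine MeasureTheory.setIntegral_mono_on hGamma (hint.const_mul _) measurableSet_Ioi ?_
        intro t ht
        have h := rpow_mul_nat_le_factorial_rpow_mul_exp ha (le_of_lt ht) j
        have hexp : exp (-(1 / 2) * t) = exp (-t) * exp (t / 2) := by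
          rw [← exp_add]; ring_nf
        rw [add_sub_cancel_right, hexp]
        calc _ ≤ exp (-t) * _ := mul_le_mul_of_nonneg_left h (exp_nonneg _)
          _ = _ := by ring
    _ = _ := by
        rw [MeasureTheory.integral_const_mul, integral_exp_mul_Ioi (by norm_num)]
        norm_num
        ring

/-- for `a > 0` there are `c, C > 0` with `(j!)^a ≥ C c^j Γ(aj+1)`. -/
theorem stmt15 (a : ℝ) (ha : 0 < a) :
    ∃ c : ℝ, 0 < c ∧ ∃ C : ℝ, 0 < C ∧ ∀ j : ℕ,
      C * c ^ j * Real.Gamma (a * j + 1) ≤ ((Nat.factorial j : ℝ) ^ a) := by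
  refine ⟨((2 * a) ^ a)⁻¹, by positivity, 1 / 2, by norm_num, fun j ↦ ?_⟩
  have hpos : 0 < (2 * a) ^ a := by positivity
  calc _ ≤ 1 / 2 * ((2 * a) ^ a)⁻¹ ^ j * (2 * ((Nat.factorial j : ℝ) ^ a * ((2 * a) ^ a) ^ j)) :=
        mul_le_mul_of_nonneg_left (Gamma_mul_nat_add_one_le ha j) (by positivity)
    _ = _ := by
        rw [inv_pow]
        field_simp
end

section
/- Let p ≥ 1 and l ≥ 0 be integers. Then there exist constants c_0, …, c_{l+1} ∈ ℝ and a function R : [0,1] → ℝ that is infinitely differentiable with all derivatives bounded on (0,1], such that for all real w with 0 < w ≤ 1: ∫_3^∞ e^{-wτ} τ^{-p} (ln τ)^l dτ = w^{p-1} Σ_{q=0}^{l+1} c_q (ln w)^q + R(w). Moreover, for p = 1, l = 0 one can take c_1 = −1 (so that ∫_3^∞ e^{-wτ} τ^{-1} dτ = −ln w + R(w)), and for p = 2, l = 0 one can take c_1 = 1. -/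
open MeasureTheory Real Set

/-- The operator `a + d/dX` on real polynomials of degree at most `n` is onto for `a ≠ 0`. -/
theorem exists_polynomial_smul_add_derivative_eq {a : ℝ} (ha : a ≠ 0) (n : ℕ) :
    ∀ P : Polynomial ℝ, P.natDegree ≤ n →
      ∃ Q : Polynomial ℝ, Q.natDegree ≤ n ∧ a • Q + Polynomial.derivative Q = P := by
  induction n with
  | zero =>
    intro P hP
    refine ⟨a⁻¹ • P, (Polynomial.natDegree_smul_le _ _).trans hP, ?_⟩
    rw [Polynomial.eq_C_of_natDegree_le_zero hP]
    rw [Polynomial.derivative_smul, Polynomial.derivative_C, smul_zero, add_zero, smul_inv_smul₀ ha]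
  | succ n ih =>
    intro P hP
    obtain ⟨Q, hQ, h⟩ := ih (Polynomial.derivative P)
      ((Polynomial.natDegree_derivative_le P).trans (by omega))
    refine ⟨a⁻¹ • (P - Q), (Polynomial.natDegree_smul_le _ _).trans
      ((Polynomial.natDegree_sub_le _ _).trans (by omega)), ?_⟩
    have h' : Polynomial.derivative P - Polynomial.derivative Q = a • Q := by rw [← h]; abel
    rw [smul_inv_smul₀ ha, Polynomial.derivative_smul, Polynomial.derivative_sub, h',
      inv_smul_smul₀ ha]
    abel

/-- Every real polynomial of degree at most `n` has an antiderivative of degree at most `n + 1`. -/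
theorem exists_polynomial_derivative_eq (n : ℕ) (P : Polynomial ℝ) (hP : P.natDegree ≤ n) :
    ∃ Q : Polynomial ℝ, Q.natDegree ≤ n + 1 ∧ Polynomial.derivative Q = P := by
  refine ⟨∑ k ∈ Finset.range (n + 1), Polynomial.monomial (k + 1) (P.coeff k / (k + 1)), ?_, ?_⟩
  · refine Polynomial.natDegree_sum_le_of_forall_le _ _ fun k hk => ?_
    have := Finset.mem_range.1 hk
    exact (Polynomial.natDegree_monomial_le _).trans (by omega)
  · conv_rhs => rw [P.as_sum_range' (n + 1) (by omega)]
    rw [Polynomial.derivative_sum]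
    refine Finset.sum_congr rfl fun k _ => ?_
    rw [Polynomial.derivative_monomial]
    congr 1
    push_cast
    field_simp

/-- Differentiation under the integral sign for Laplace-type integrals. -/
theorem hasDerivAt_setIntegral_exp_neg_mul {s : Set ℝ} (hs : MeasurableSet s) (hs0 : s ⊆ Ici 0)
    {g : ℝ → ℝ} (hg : Measurable g) {v w : ℝ} (hvw : v < w)
    (hw : IntegrableOn (fun τ => Real.exp (-(w * τ)) * g τ) s)
    (hv : IntegrableOn (fun τ => Real.exp (-(v * τ)) * (τ * g τ)) s) :
    HasDerivAt (fun x => ∫ τ in s, Real.exp (-(x * τ)) * g τ)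
      (-∫ τ in s, Real.exp (-(w * τ)) * (τ * g τ)) w := by
  rw [← integral_neg]
  refine (hasDerivAt_integral_of_dominated_loc_of_deriv_le (Ioi_mem_nhds hvw)
    (.of_forall fun x => ?_) hw.integrable (F' := fun x τ => -(Real.exp (-(x * τ)) * (τ * g τ)))
    ?_ ?_ hv.integrable.norm ?_).2
  · exact Measurable.aestronglyMeasurable (by fun_prop)
  · exact Measurable.aestronglyMeasurable (by fun_prop)
  · refine (ae_restrict_iff' hs).2 (.of_forall fun τ hτ x hx => ?_)
    have h0 : 0 ≤ τ := hs0 hτ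
    have hx' : v ≤ x := le_of_lt hx
    simp only [norm_neg, norm_mul, Real.norm_eq_abs, Real.abs_exp]
    gcongr
  · refine .of_forall fun τ x _ => ?_
    have h : HasDerivAt (fun x => -(x * τ)) (-(1 * τ)) x := ((hasDerivAt_id x).mul_const τ).neg
    exact (h.exp.mul_const (g τ)).congr_deriv (by ring)

theorem abs_log_pow_le {x : ℝ} (hx : 0 < x) (l : ℕ) :
    |Real.log x ^ l| ≤ 2 ^ l * l.factorial * (x ^ (1 / 2 : ℝ) + x ^ (-(1 / 2) : ℝ)) := by
  have h := Real.pow_div_factorial_le_exp (|Real.log x| / 2) (by positivity) l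
  have h2 : Real.exp (|Real.log x| / 2) ≤ x ^ (1 / 2 : ℝ) + x ^ (-(1 / 2) : ℝ) := by
    rw [Real.rpow_def_of_pos hx, Real.rpow_def_of_pos hx]
    rcases abs_cases (Real.log x) with ⟨h, _⟩ | ⟨h, _⟩ <;> rw [h]
    · refine le_add_of_le_of_nonneg (le_of_eq ?_) (Real.exp_nonneg _)
      ring_nf
    · refine le_add_of_nonneg_of_le (Real.exp_nonneg _) (le_of_eq ?_)
      ring_nf
  rw [div_le_iff₀ (by positivity), div_pow, div_le_iff₀ (by positivity)] at h
  rw [abs_pow]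
  refine h.trans ?_
  have : 0 ≤ (2 : ℝ) ^ l * l.factorial := by positivity
  nlinarith [mul_le_mul_of_nonneg_left h2 this]

theorem integrableOn_Ioi_exp_neg_mul_pow_mul_log_pow {w : ℝ} (hw : 0 < w) (k l : ℕ) :
    IntegrableOn (fun τ => Real.exp (-(w * τ)) * (τ ^ k * Real.log τ ^ l)) (Ioi 0) := by
  have hr (r : ℝ) (hr : -1 < r) :
      IntegrableOn (fun τ => τ ^ r * Real.exp (-(w * τ))) (Ioi 0) := by
    simpa using integrableOn_rpow_mul_exp_neg_mul_rpow hr one_pos hw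
  have hk : (0 : ℝ) ≤ k := k.cast_nonneg
  refine (((hr (k + 1 / 2) (by linarith)).add (hr (k + -(1 / 2)) (by linarith))).const_mul
    (2 ^ l * l.factorial)).mono' (Measurable.aestronglyMeasurable (by fun_prop))
    ((ae_restrict_iff' measurableSet_Ioi).2 (.of_forall fun τ hτ => ?_))
  have hτ : 0 < τ := hτ
  simp only [Pi.add_apply]
  rw [Real.rpow_add hτ, Real.rpow_add hτ, Real.rpow_natCast, norm_mul, norm_mul,
    Real.norm_of_nonneg (Real.exp_nonneg _), Real.norm_of_nonneg (pow_nonneg hτ.le _),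
    Real.norm_eq_abs]
  calc _ ≤ Real.exp (-(w * τ)) * (τ ^ k * (2 ^ l * l.factorial *
        (τ ^ (1 / 2 : ℝ) + τ ^ (-(1 / 2) : ℝ)))) := by
        gcongr
        exact abs_log_pow_le hτ l
    _ = _ := by ring

theorem integrableOn_Ioc_exp_neg_mul_pow_mul_log_pow (w b : ℝ) (k l : ℕ) :
    IntegrableOn (fun τ => Real.exp (-(w * τ)) * (τ ^ k * Real.log τ ^ l)) (Ioc 0 b) := by
  have h := (integrableOn_Ioi_exp_neg_mul_pow_mul_log_pow one_pos k l).mono_set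
    (Ioc_subset_Ioi_self : Ioc 0 b ⊆ Ioi 0)
  rw [← integrableOn_Icc_iff_integrableOn_Ioc] at h ⊢
  have := h.continuousOn_mul (g := fun τ => Real.exp (τ - w * τ)) (by fun_prop) isCompact_Icc
  refine this.congr_fun (fun τ _ => ?_) measurableSet_Icc
  simp only [← mul_assoc, ← Real.exp_add]
  ring_nf

theorem integrableOn_Ioi_exp_neg_mul_inv_pow_mul_log_pow {w a : ℝ} (hw : 0 < w) (ha : 1 ≤ a)
    (p l : ℕ) :
    IntegrableOn (fun τ => Real.exp (-(w * τ)) * ((τ ^ p)⁻¹ * Real.log τ ^ l)) (Ioi a) := by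
  refine ((integrableOn_Ioi_exp_neg_mul_pow_mul_log_pow hw 0 l).mono_set
    (Ioi_subset_Ioi (by linarith : 0 ≤ a))).integrable.mono
    (Measurable.aestronglyMeasurable (by fun_prop))
    ((ae_restrict_iff' measurableSet_Ioi).2 (.of_forall fun τ hτ => ?_))
  have hτ : 1 ≤ τ := ha.trans (le_of_lt hτ)
  have h1 : ‖(τ ^ p)⁻¹‖ ≤ ‖τ ^ 0‖ := by
    rw [Real.norm_of_nonneg (by positivity), pow_zero, norm_one]
    exact inv_le_one_of_one_le₀ (one_le_pow₀ hτ)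
  rw [norm_mul, norm_mul, norm_mul, norm_mul]
  gcongr

/-- Truncated Laplace transforms of `τ ^ k * log τ ^ l` near the origin are smooth. -/
theorem contDiff_setIntegral_Ioc_exp_neg_mul (b : ℝ) (l : ℕ) :
    ContDiff ℝ (⊤ : ℕ∞)
      (fun w => ∫ τ in Ioc 0 b, Real.exp (-(w * τ)) * Real.log τ ^ l) := by
  have hd (k : ℕ) (w : ℝ) :
      HasDerivAt (fun w => ∫ τ in Ioc 0 b, Real.exp (-(w * τ)) * (τ ^ k * Real.log τ ^ l))
        (-∫ τ in Ioc 0 b, Real.exp (-(w * τ)) * (τ ^ (k + 1) * Real.log τ ^ l)) w := by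
    have h := hasDerivAt_setIntegral_exp_neg_mul (g := fun τ => τ ^ k * Real.log τ ^ l)
      measurableSet_Ioc (s := Ioc 0 b) (fun x hx => hx.1.le) (by fun_prop) (sub_one_lt w)
      (integrableOn_Ioc_exp_neg_mul_pow_mul_log_pow w b k l)
      (by simpa only [pow_succ', mul_assoc] using
        integrableOn_Ioc_exp_neg_mul_pow_mul_log_pow (w - 1) b (k + 1) l)
    simpa only [pow_succ', mul_assoc] using h
  have hc (n : ℕ) : ∀ k : ℕ, ContDiff ℝ n
      (fun w => ∫ τ in Ioc 0 b, Real.exp (-(w * τ)) * (τ ^ k * Real.log τ ^ l)) := by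
    induction n with
    | zero =>
      intro k
      rw [Nat.cast_zero, contDiff_zero]
      exact continuous_iff_continuousAt.2 fun w => (hd k w).continuousAt
    | succ n ih =>
      intro k
      push_cast
      refine contDiff_succ_iff_deriv.2 ⟨fun w => (hd k w).differentiableAt, by simp, ?_⟩
      rw [funext fun w => (hd k w).deriv]
      exact (ih (k + 1)).neg
  simpa using contDiff_infty.2 fun n => hc n 0

/-- The full Laplace transform of `log τ ^ l` is `w⁻¹` times a polynomial in `log w`. -/
theorem exists_polynomial_setIntegral_Ioi_exp_neg_mul_log_pow (l : ℕ) :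
    ∃ P : Polynomial ℝ, P.natDegree ≤ l ∧ P.coeff l = (-1) ^ l ∧ ∀ w : ℝ, 0 < w →
      ∫ τ in Ioi 0, Real.exp (-(w * τ)) * Real.log τ ^ l = w⁻¹ * P.eval (Real.log w) := by
  have hi (j : ℕ) : IntegrableOn (fun u => Real.exp (-u) * Real.log u ^ j) (Ioi 0) := by
    simpa using integrableOn_Ioi_exp_neg_mul_pow_mul_log_pow one_pos 0 j
  refine ⟨∑ k ∈ Finset.range (l + 1), Polynomial.monomial k
    ((-1) ^ k * l.choose k * ∫ u in Ioi 0, Real.exp (-u) * Real.log u ^ (l - k)), ?_, ?_, ?_⟩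
  · refine Polynomial.natDegree_sum_le_of_forall_le _ _ fun k hk => ?_
    have := Finset.mem_range.1 hk
    exact (Polynomial.natDegree_monomial_le _).trans (by omega)
  · simp [Polynomial.finsetSum_coeff, Polynomial.coeff_monomial, -integral_comp_neg_Ioi,
      integral_exp_neg_Ioi_zero]
  · intro w hw
    have h := integral_comp_mul_left_Ioi
      (fun u => Real.exp (-u) * (Real.log u - Real.log w) ^ l) 0 hw
    rw [mul_zero, smul_eq_mul] at h
    calc _ = ∫ τ in Ioi 0, Real.exp (-(w * τ)) * (Real.log (w * τ) - Real.log w) ^ l := by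
          refine setIntegral_congr_fun measurableSet_Ioi fun τ hτ => ?_
          rw [Real.log_mul hw.ne' (ne_of_gt hτ), add_sub_cancel_left]
      _ = _ := h
      _ = _ := by
          congr 1
          rw [Polynomial.eval_finsetSum]
          have (u : ℝ) : Real.exp (-u) * (Real.log u - Real.log w) ^ l =
              ∑ k ∈ Finset.range (l + 1), ((-1) ^ k * l.choose k * Real.log w ^ k) *
                (Real.exp (-u) * Real.log u ^ (l - k)) := by
            rw [sub_eq_neg_add, add_pow, Finset.mul_sum]
            refine Finset.sum_congr rfl fun k _ => ?_
            rw [neg_pow]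
            ring
          simp only [this]
          rw [integral_finsetSum _ fun k _ => (hi (l - k)).const_mul _]
          refine Finset.sum_congr rfl fun k _ => ?_
          rw [integral_const_mul, Polynomial.eval_monomial]
          ring

/-- Integrating a function of the form `w ^ (m - 1) * P (log w) + R w` with `R` smooth. -/
theorem exists_contDiff_of_hasDerivAt_pow_mul_eval_log {F R : ℝ → ℝ} {P Q : Polynomial ℝ} {m : ℕ}
    (hR : ContDiff ℝ (⊤ : ℕ∞) R)
    (hF : ∀ w, 0 < w → HasDerivAt F (-(w ^ m * w⁻¹ * P.eval (Real.log w) + R w)) w)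
    (hQ : (m : ℝ) • Q + Polynomial.derivative Q = -P) :
    ∃ S : ℝ → ℝ, ContDiff ℝ (⊤ : ℕ∞) S ∧
      ∀ w, 0 < w → F w = w ^ m * Q.eval (Real.log w) + S w := by
  have hS (w : ℝ) : HasDerivAt (fun w => F 1 - Q.eval 0 - ∫ x in (1 : ℝ)..w, R x) (-R w) w :=
    (hR.continuous.integral_hasStrictDerivAt 1 w).hasDerivAt.const_sub _
  refine ⟨fun w => F 1 - Q.eval 0 - ∫ x in (1 : ℝ)..w, R x, ?_, ?_⟩
  · refine contDiff_infty_iff_deriv.2 ⟨fun w => (hS w).differentiableAt, ?_⟩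
    rw [funext fun w => (hS w).deriv]
    exact hR.neg
  · have hG (w : ℝ) (hw : 0 < w) : HasDerivAt
        (fun w => w ^ m * Q.eval (Real.log w) + (F 1 - Q.eval 0 - ∫ x in (1 : ℝ)..w, R x))
        (-(w ^ m * w⁻¹ * P.eval (Real.log w) + R w)) w := by
      have h := ((hasDerivAt_pow m w).mul
        ((Q.hasDerivAt (Real.log w)).comp w (Real.hasDerivAt_log hw.ne'))).add (hS w)
      refine h.congr_deriv ?_
      have hm : (m : ℝ) * w ^ (m - 1) = m * (w ^ m * w⁻¹) := by
        cases m with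
        | zero => simp
        | succ m => rw [Nat.add_sub_cancel, pow_succ, mul_inv_cancel_right₀ hw.ne']
      have hP : P.eval (Real.log w) =
          -(m * Q.eval (Real.log w) + (Polynomial.derivative Q).eval (Real.log w)) := by
        rw [← neg_neg P, ← hQ]
        simp
      rw [hm, hP]
      simp only [Function.comp_apply]
      ring
    refine isOpen_Ioi.eqOn_of_deriv_eq isPreconnected_Ioi
      (fun w hw => (hF w hw).differentiableAt.differentiableWithinAt)
      (fun w hw => (hG w hw).differentiableAt.differentiableWithinAt)
      (fun w hw => ?_) (mem_Ioi.2 one_pos) ?_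
    · rw [(hF w hw).deriv, (hG w hw).deriv]
    · simp

theorem hasDerivAt_setIntegral_Ioi_exp_neg_mul_inv_pow (p l : ℕ) {a w : ℝ} (ha : 1 ≤ a)
    (hw : 0 < w) :
    HasDerivAt (fun w => ∫ τ in Ioi a, Real.exp (-(w * τ)) * ((τ ^ (p + 1))⁻¹ * Real.log τ ^ l))
      (-∫ τ in Ioi a, Real.exp (-(w * τ)) * ((τ ^ p)⁻¹ * Real.log τ ^ l)) w := by
  have ha0 : 0 < a := by linarith
  have he (v : ℝ) : EqOn (fun τ => Real.exp (-(v * τ)) * ((τ ^ p)⁻¹ * Real.log τ ^ l))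
      (fun τ => Real.exp (-(v * τ)) * (τ * ((τ ^ (p + 1))⁻¹ * Real.log τ ^ l))) (Ioi a) := by
    intro τ hτ
    have : τ ≠ 0 := (ha0.trans hτ).ne'
    simp only
    field_simp
    ring
  rw [setIntegral_congr_fun measurableSet_Ioi (he w)]
  exact hasDerivAt_setIntegral_exp_neg_mul measurableSet_Ioi (fun x hx => (ha0.trans hx).le)
    (by fun_prop) (half_lt_self hw)
    (integrableOn_Ioi_exp_neg_mul_inv_pow_mul_log_pow hw ha (p + 1) l)
    ((integrableOn_Ioi_exp_neg_mul_inv_pow_mul_log_pow (half_pos hw) ha p l).congr_fun (he _)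
      measurableSet_Ioi)

/-- Expansion at `w = 0` of `∫_a^∞ e^{-wτ} τ^{-(m+1)} (log τ)^l dτ`, with the leading coefficient
of the logarithmic part. -/
theorem exists_polynomial_setIntegral_Ioi_exp_neg_mul_inv_pow {a : ℝ} (ha : 1 ≤ a) (l m : ℕ) :
    ∃ P : Polynomial ℝ, P.natDegree ≤ l + 1 ∧
      P.coeff (l + 1) = (-1) ^ (l + 1 + m) / ((l + 1) * m.factorial) ∧
      ∃ R : ℝ → ℝ, ContDiff ℝ (⊤ : ℕ∞) R ∧ ∀ w, 0 < w →
        ∫ τ in Ioi a, Real.exp (-(w * τ)) * ((τ ^ (m + 1))⁻¹ * Real.log τ ^ l) =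
          w ^ m * P.eval (Real.log w) + R w := by
  induction m with
  | zero =>
    obtain ⟨P, hP, hPl, h⟩ := exists_polynomial_setIntegral_Ioi_exp_neg_mul_log_pow l
    obtain ⟨Q, hQ, hQP⟩ := exists_polynomial_derivative_eq l (-P) (by simpa using hP)
    refine ⟨Q, hQ, ?_, exists_contDiff_of_hasDerivAt_pow_mul_eval_log (P := P)
      (contDiff_setIntegral_Ioc_exp_neg_mul a l).neg (fun w hw => ?_) (by simpa using hQP)⟩
    · have := congrArg (Polynomial.coeff · l) hQP
      simp only [Polynomial.coeff_derivative, Polynomial.coeff_neg, hPl] at this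
      rw [Nat.factorial_zero, Nat.cast_one, mul_one, add_zero, pow_succ, mul_neg_one, ← this]
      field_simp
    · convert hasDerivAt_setIntegral_Ioi_exp_neg_mul_inv_pow 0 l ha hw using 2
      have hi := integrableOn_Ioi_exp_neg_mul_pow_mul_log_pow hw 0 l
      simp only [pow_zero, one_mul] at hi
      have hu := setIntegral_union (Ioc_disjoint_Ioi le_rfl) measurableSet_Ioi
        (hi.mono_set (Ioc_subset_Ioi_self : Ioc 0 a ⊆ Ioi 0))
        (hi.mono_set (Ioi_subset_Ioi (by linarith : 0 ≤ a)))
      rw [Ioc_union_Ioi_eq_Ioi (by linarith), h w hw] at hu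
      simp only [pow_zero, one_mul, inv_one]
      linarith
  | succ m ih =>
    obtain ⟨P, hP, hPl, R, hR, h⟩ := ih
    have hm : ((m + 1 : ℕ) : ℝ) ≠ 0 := by positivity
    obtain ⟨Q, hQ, hQP⟩ := exists_polynomial_smul_add_derivative_eq hm (l + 1) (-P)
      (by simpa using hP)
    refine ⟨Q, hQ, ?_, exists_contDiff_of_hasDerivAt_pow_mul_eval_log (P := P) hR
      (fun w hw => ?_) hQP⟩
    · have := congrArg (Polynomial.coeff · (l + 1)) hQP
      simp only [Polynomial.coeff_add, Polynomial.coeff_smul, Polynomial.coeff_derivative,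
        Polynomial.coeff_neg, hPl, smul_eq_mul,
        Polynomial.coeff_eq_zero_of_natDegree_lt (Nat.lt_succ_of_le hQ), zero_mul, add_zero] at this
      rw [eq_div_iff (by positivity), Nat.factorial_succ]
      rw [← neg_div, eq_div_iff (by positivity)] at this
      push_cast at this ⊢
      rw [← add_assoc, pow_succ, mul_neg_one, ← this]
      ring
    · rw [pow_succ, mul_inv_cancel_right₀ hw.ne', ← h w hw]
      exact hasDerivAt_setIntegral_Ioi_exp_neg_mul_inv_pow (m + 1) l ha hw

theorem exists_bound_iteratedDerivWithin_Ioc {R : ℝ → ℝ} (hR : ContDiff ℝ (⊤ : ℕ∞) R)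
    (a b : ℝ) (k : ℕ) :
    ∃ M : ℝ, ∀ w ∈ Ioc a b, |iteratedDerivWithin k R (Ioc a b) w| ≤ M := by
  have hk : ((k : ℕ∞) : WithTop ℕ∞) ≤ (⊤ : ℕ∞) := by exact_mod_cast le_top
  obtain ⟨M, hM⟩ := isCompact_Icc.exists_bound_of_continuousOn (s := Icc a b)
    (hR.continuous_iteratedDeriv k hk).continuousOn
  refine ⟨M, fun w hw => ?_⟩
  rw [iteratedDerivWithin_eq_iteratedDeriv (uniqueDiffOn_Ioc a b) (hR.of_le hk).contDiffAt hw]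
  exact hM w (Ioc_subset_Icc_self hw)

/-- for integers `p ≥ 1`, `l ≥ 0`, there are constants `c_0,…,c_{l+1}`
and a remainder `R`, smooth with all derivatives bounded on `(0,1]`, such that
`∫_3^∞ e^{-wτ} τ^{-p} (ln τ)^l dτ = w^{p-1} Σ_{q=0}^{l+1} c_q (ln w)^q + R(w)` for
`0 < w ≤ 1`; moreover for `p = 1, l = 0` one can take `c_1 = −1`, and for
`p = 2, l = 0` one can take `c_1 = 1`. -/
theorem stmt17 (p l : ℕ) (hp : 1 ≤ p) :
    ∃ c : ℕ → ℝ, ∃ R : ℝ → ℝ,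
      ContDiffOn ℝ (⊤ : ℕ∞) R (Set.Ioc 0 1) ∧
      (∀ k : ℕ, ∃ M : ℝ, ∀ w ∈ Set.Ioc (0 : ℝ) 1,
        |iteratedDerivWithin k R (Set.Ioc 0 1) w| ≤ M) ∧
      (∀ w ∈ Set.Ioc (0 : ℝ) 1,
        (∫ τ in Set.Ioi (3 : ℝ), Real.exp (-(w * τ)) * (τ ^ p)⁻¹ * Real.log τ ^ l)
          = w ^ (p - 1) * (∑ q ∈ Finset.Iic (l + 1), c q * Real.log w ^ q) + R w) ∧
      (p = 1 ∧ l = 0 → c 1 = -1) ∧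
      (p = 2 ∧ l = 0 → c 1 = 1) := by
  obtain ⟨m, rfl⟩ : ∃ m, p = m + 1 := ⟨p - 1, by omega⟩
  obtain ⟨P, hP, hPl, R, hR, h⟩ :=
    exists_polynomial_setIntegral_Ioi_exp_neg_mul_inv_pow (a := 3) (by norm_num) l m
  refine ⟨P.coeff, R, hR.contDiffOn, exists_bound_iteratedDerivWithin_Ioc hR 0 1,
    fun w hw => ?_, ?_, ?_⟩
  · have hr : Finset.Iic (l + 1) = Finset.range (l + 2) := by
      ext q
      simp only [Finset.mem_Iic, Finset.mem_range]
      omega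
    simp only [mul_assoc]
    rw [h w hw.1, Nat.add_sub_cancel, hr,
      Polynomial.eval_eq_sum_range' (Nat.lt_succ_of_le hP)]
  · rintro ⟨hm, rfl⟩
    obtain rfl : m = 0 := by omega
    simpa using hPl
  · rintro ⟨hm, rfl⟩
    obtain rfl : m = 1 := by omega
    simpa using hPl
end

section
/- Let k ≥ 1 be an integer and let ψ : ℝ → ℝ be measurable with ⟨x⟩^{k} ψ(x) ∈ L¹(ℝ). Define for x ∈ ℝ and t ≥ 0: G(x,t) = (1/2) ∫_{t+x}^{x} e^{-t+u-x} ψ(u) du − (1/2) ∫_{x-t}^{x} e^{-t-u+x} ψ(u) du. Then there is a constant C depending only on k such that |G(x,t)| ≤ C (⟨x⟩/⟨t⟩)^{k} ‖⟨x⟩^{k} ψ‖_{L¹} for all x ∈ ℝ and all t ≥ 0. -/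
open MeasureTheory Filter Set Real

/-- The "Japanese bracket" `⟨x⟩ = (1 + x²)^{1/2}`. -/
noncomputable def jb (x : ℝ) : ℝ := Real.sqrt (1 + x ^ 2)

lemma one_le_jb (x : ℝ) : 1 ≤ jb x :=
  Real.one_le_sqrt.mpr (by nlinarith [sq_nonneg x])

lemma jb_pos (x : ℝ) : 0 < jb x := one_pos.trans_le (one_le_jb x)

lemma jb_neg (x : ℝ) : jb (-x) = jb x := by simp [jb]

lemma jb_add_le (a b : ℝ) : jb (a + b) ≤ √2 * (jb a * jb b) := by
  unfold jb
  rw [← Real.sqrt_mul (by positivity), ← Real.sqrt_mul (by positivity)]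
  apply Real.sqrt_le_sqrt
  nlinarith [sq_nonneg (a - b), sq_nonneg (a * b)]

lemma jb_add_add_le (a b c : ℝ) : jb (a + (b + c)) ≤ 2 * (jb a * jb b * jb c) := by
  have h2 : √2 * √2 = (2 : ℝ) := Real.mul_self_sqrt (by norm_num)
  calc jb (a + (b + c)) ≤ √2 * (jb a * jb (b + c)) := jb_add_le _ _
    _ ≤ √2 * (jb a * (√2 * (jb b * jb c))) := by
        have := jb_add_le b c
        have := (jb_pos a).le
        gcongr
    _ = (√2 * √2) * (jb a * jb b * jb c) := by ring
    _ = _ := by rw [h2]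

lemma exp_neg_mul_jb_pow_le (k : ℕ) {w : ℝ} (hw : 0 ≤ w) :
    Real.exp (-w) * jb w ^ k ≤ k.factorial * Real.exp 1 := by
  have hjb : jb w ≤ 1 + w := by
    unfold jb
    exact Real.sqrt_le_iff.mpr ⟨by linarith, by nlinarith⟩
  have h := Real.pow_div_factorial_le_exp (1 + w) (by linarith) k
  rw [div_le_iff₀ (by positivity)] at h
  calc Real.exp (-w) * jb w ^ k ≤ Real.exp (-w) * (Real.exp (1 + w) * k.factorial) := by
        have := (jb_pos w).le
        gcongr
        exact (pow_le_pow_left₀ this hjb k).trans h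
    _ = (Real.exp (-w) * Real.exp (1 + w)) * k.factorial := by ring
    _ = k.factorial * Real.exp 1 := by
        rw [← Real.exp_add, mul_comm]
        congr 2
        ring

/-- Exponential decay in the first summand of `w + (u + x)` dominates the weight `⟨w + (u + x)⟩⁻ᵏ`
up to the weights `⟨u⟩ᵏ` and `⟨x⟩ᵏ`. -/
lemma exp_neg_le_weight (k : ℕ) {w : ℝ} (hw : 0 ≤ w) (u x : ℝ) :
    Real.exp (-w) ≤ 2 ^ k * (k.factorial * Real.exp 1) * (jb x / jb (w + (u + x))) ^ k
      * jb u ^ k := by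
  have ht := jb_pos (w + (u + x))
  have hx := jb_pos x
  have hu := jb_pos u
  rw [div_pow, mul_div_assoc', div_mul_eq_mul_div, le_div_iff₀ (by positivity)]
  calc Real.exp (-w) * jb (w + (u + x)) ^ k
      ≤ Real.exp (-w) * (2 * (jb w * jb u * jb x)) ^ k := by
        gcongr
        exact jb_add_add_le _ _ _
    _ = 2 ^ k * (Real.exp (-w) * jb w ^ k) * jb x ^ k * jb u ^ k := by ring
    _ ≤ _ := mul_le_mul_of_nonneg_right (mul_le_mul_of_nonneg_right
        (mul_le_mul_of_nonneg_left (exp_neg_mul_jb_pow_le k hw) (by positivity))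
        (by positivity)) (by positivity)

lemma abs_intervalIntegral_le_integral {f g : ℝ → ℝ} {a b : ℝ} (hg : Integrable g)
    (hg0 : ∀ u, 0 ≤ g u) (h : ∀ u ∈ Set.uIoc a b, |f u| ≤ g u) :
    |∫ u in a..b, f u| ≤ ∫ u, g u := by
  rw [← Real.norm_eq_abs, intervalIntegral.norm_intervalIntegral_eq]
  calc ‖∫ u in Set.uIoc a b, f u‖ ≤ ∫ u in Set.uIoc a b, g u :=
        norm_integral_le_of_norm_le hg.integrableOn
          ((ae_restrict_iff' measurableSet_uIoc).mpr (ae_of_all _ h))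
    _ ≤ ∫ u, g u := setIntegral_le_integral hg (ae_of_all _ hg0)

/-- the inverse Laplace transform of the free-resolvent term,
`G(x,t) = ½∫_{t+x}^x e^{-t+u-x} ψ(u) du − ½∫_{x−t}^x e^{−t−u+x} ψ(u) du`,
satisfies `|G(x,t)| ≤ C (⟨x⟩/⟨t⟩)^k ‖⟨x⟩^k ψ‖_{L¹}`. -/
theorem stmt18 (k : ℕ) (hk : 1 ≤ k) :
    ∃ C : ℝ, ∀ ψ : ℝ → ℝ, Measurable ψ →
      Integrable (fun x => jb x ^ k * ψ x) →
      ∀ x : ℝ, ∀ t : ℝ, 0 ≤ t →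
        |(1 / 2) * (∫ u in (t + x)..x, Real.exp (-t + u - x) * ψ u)
            - (1 / 2) * ∫ u in (x - t)..x, Real.exp (-t - u + x) * ψ u|
          ≤ C * (jb x / jb t) ^ k * ∫ y : ℝ, |jb y ^ k * ψ y| := by
  refine ⟨2 ^ k * (k.factorial * Real.exp 1), fun ψ _ hψ x t ht => ?_⟩
  set K : ℝ := 2 ^ k * (k.factorial * Real.exp 1) * (jb x / jb t) ^ k with hK
  have hK0 : 0 ≤ K := by
    have := jb_pos x
    have := jb_pos t
    positivity
  have hg : Integrable fun u => K * |jb u ^ k * ψ u| := hψ.abs.const_mul K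
  have hg0 : ∀ u, 0 ≤ K * |jb u ^ k * ψ u| := fun u => by positivity
  have key : ∀ u e : ℝ, Real.exp e ≤ K * jb u ^ k →
      |Real.exp e * ψ u| ≤ K * |jb u ^ k * ψ u| := fun u e he => by
    rw [abs_mul, abs_mul, abs_of_pos (Real.exp_pos e), abs_of_pos (pow_pos (jb_pos u) k),
      ← mul_assoc]
    gcongr
  have h1 : |∫ u in (t + x)..x, Real.exp (-t + u - x) * ψ u| ≤ ∫ u, K * |jb u ^ k * ψ u| := by
    refine abs_intervalIntegral_le_integral hg hg0 fun u hu => key u _ ?_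
    rw [Set.uIoc_of_ge (by linarith)] at hu
    have h := exp_neg_le_weight k (w := t + x - u) (by linarith [hu.2]) u (-x)
    rw [jb_neg, show t + x - u + (u + -x) = t by ring,
      show -(t + x - u) = -t + u - x by ring] at h
    exact h
  have h2 : |∫ u in (x - t)..x, Real.exp (-t - u + x) * ψ u| ≤ ∫ u, K * |jb u ^ k * ψ u| := by
    refine abs_intervalIntegral_le_integral hg hg0 fun u hu => key u _ ?_
    rw [Set.uIoc_of_le (by linarith)] at hu
    have h := exp_neg_le_weight k (w := t + u - x) (by linarith [hu.1]) (-u) x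
    rw [jb_neg, show t + u - x + (-u + x) = t by ring,
      show -(t + u - x) = -t - u + x by ring] at h
    exact h
  rw [integral_const_mul] at h1 h2
  rw [abs_le] at h1 h2 ⊢
  constructor <;> linarith [h1.1, h1.2, h2.1, h2.2]
end

section
/- Let m ≥ 3 be an integer. Then there exists a constant C depending only on m such that for all real a ≥ 1 and all real t ≥ 1: | ∫_0^{1/2} e^{-εt} ε^{m-1} (1 + εa)^{-(m+1)} dε − (m−1)! t^{-m} | ≤ C a t^{-m-1}. -/
open MeasureTheory Real

/-- The Gamma integral with an exponential rate, for natural exponents. -/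
lemma integral_pow_mul_exp_neg_mul_Ioi (k : ℕ) {t : ℝ} (ht : 0 < t) :
    ∫ x in Set.Ioi (0 : ℝ), Real.exp (-(x * t)) * x ^ k = (Nat.factorial k : ℝ) / t ^ (k + 1) := by
  have key := integral_rpow_mul_exp_neg_mul_Ioi (a := (k : ℝ) + 1) (by positivity) ht
  rw [Real.Gamma_nat_eq_factorial] at key
  have h1 : (1 / t) ^ ((k : ℝ) + 1) = (1 / t) ^ (k + 1) := by
    rw [← Nat.cast_add_one, rpow_natCast]
  rw [h1] at key
  simp only [add_sub_cancel_right, rpow_natCast] at key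
  calc _ = ∫ x in Set.Ioi (0 : ℝ), x ^ k * Real.exp (-(t * x)) := by
        simp only [mul_comm]
    _ = _ := by rw [key, one_div, inv_pow, div_eq_inv_mul]

lemma integrableOn_pow_mul_exp_neg_mul_Ioi (k : ℕ) {t : ℝ} (ht : 0 < t) :
    IntegrableOn (fun x : ℝ => Real.exp (-(x * t)) * x ^ k) (Set.Ioi 0) :=
  .of_integral_ne_zero (by
    rw [integral_pow_mul_exp_neg_mul_Ioi k ht]
    positivity)

lemma one_sub_inv_one_add_pow_le {x : ℝ} (hx : 0 ≤ x) (n : ℕ) :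
    1 - ((1 + x) ^ n)⁻¹ ≤ n * x := by
  have hinv : (1 + x) * (1 + x)⁻¹ = 1 := mul_inv_cancel₀ (by positivity)
  have hpos : 0 < (1 + x)⁻¹ := by positivity
  have h := one_add_mul_le_pow (a := (1 + x)⁻¹ - 1) (by linarith) n
  rw [add_sub_cancel, inv_pow] at h
  have h2 : 1 - (1 + x)⁻¹ ≤ x := by nlinarith
  have h3 := mul_le_mul_of_nonneg_left h2 (Nat.cast_nonneg (α := ℝ) n)
  linarith

/-- Watson-lemma asymptotics of the Laplace-type integral
`∫_0^{1/2} e^{-εt} ε^{m-1}(1+εa)^{-(m+1)} dε`, with error at most `C a t^{-m-1}`. -/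
theorem stmt19 (m : ℕ) (hm : 3 ≤ m) :
    ∃ C : ℝ, ∀ a : ℝ, 1 ≤ a → ∀ t : ℝ, 1 ≤ t →
      |(∫ ε in (0 : ℝ)..(1 / 2),
          Real.exp (-(ε * t)) * ε ^ (m - 1) * ((1 + ε * a) ^ (m + 1))⁻¹)
          - (Nat.factorial (m - 1) : ℝ) / t ^ m|
        ≤ C * a / t ^ (m + 1) := by
  refine ⟨(m + 1) * (Nat.factorial m : ℝ), fun a ha t ht => ?_⟩
  have ht0 : 0 < t := by linarith
  obtain ⟨k, rfl⟩ : ∃ k, m = k + 1 := ⟨m - 1, by omega⟩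
  simp only [Nat.add_sub_cancel]
  set F : ℝ → ℝ := fun ε => Real.exp (-(ε * t)) * ε ^ k * ((1 + ε * a) ^ (k + 1 + 1))⁻¹ with hF
  have hFint : IntegrableOn F (Set.Ioc 0 (1 / 2)) := by
    rw [← intervalIntegrable_iff_integrableOn_Ioc_of_le (by norm_num)]
    refine ContinuousOn.intervalIntegrable_of_Icc (by norm_num) ?_
    refine ContinuousOn.mul (by fun_prop) (ContinuousOn.inv₀ (by fun_prop) fun x hx => ?_)
    have := hx.1
    positivity
  have hind : IntegrableOn ((Set.Ioc (0 : ℝ) (1 / 2)).indicator F) (Set.Ioi 0) :=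
    (hFint.integrable_indicator measurableSet_Ioc).integrableOn
  have hI : ∫ ε in (0 : ℝ)..(1 / 2), F ε =
      ∫ ε in Set.Ioi (0 : ℝ), (Set.Ioc (0 : ℝ) (1 / 2)).indicator F ε := by
    rw [intervalIntegral.integral_of_le (by norm_num), setIntegral_indicator measurableSet_Ioc,
      Set.inter_eq_right.mpr Set.Ioc_subset_Ioi_self]
  rw [hI, ← integral_pow_mul_exp_neg_mul_Ioi k ht0,
    ← integral_sub hind (integrableOn_pow_mul_exp_neg_mul_Ioi k ht0), ← Real.norm_eq_abs]
  have hH := (integrableOn_pow_mul_exp_neg_mul_Ioi (k + 1) ht0).const_mul (((k + 1 + 1 : ℕ) : ℝ) * a)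
  refine (norm_integral_le_of_norm_le hH ?_).trans_eq ?_
  · refine (ae_restrict_iff' measurableSet_Ioi).mpr (ae_of_all _ fun x hx => ?_)
    have hx0 : (0 : ℝ) < x := hx
    have hG : 0 ≤ Real.exp (-(x * t)) * x ^ k := by positivity
    have hxa : 0 ≤ x * a := by positivity
    have hR : ((k + 1 + 1 : ℕ) : ℝ) * a * (Real.exp (-(x * t)) * x ^ (k + 1)) =
        Real.exp (-(x * t)) * x ^ k * (((k + 1 + 1 : ℕ) : ℝ) * (x * a)) := by ring
    rw [hR, Real.norm_eq_abs, abs_sub_comm]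
    by_cases hxm : x ∈ Set.Ioc (0 : ℝ) (1 / 2)
    · rw [Set.indicator_of_mem hxm]
      have h1 : ((1 + x * a) ^ (k + 1 + 1))⁻¹ ≤ 1 :=
        inv_le_one_of_one_le₀ (one_le_pow₀ (by linarith))
      have h2 := one_sub_inv_one_add_pow_le hxa (k + 1 + 1)
      rw [show Real.exp (-(x * t)) * x ^ k - F x = Real.exp (-(x * t)) * x ^ k *
        (1 - ((1 + x * a) ^ (k + 1 + 1))⁻¹) by simp only [hF]; ring,
        abs_of_nonneg (mul_nonneg hG (by linarith))]
      exact mul_le_mul_of_nonneg_left h2 hG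
    · rw [Set.indicator_of_notMem hxm, sub_zero, abs_of_nonneg hG]
      have hx2 : 1 / 2 < x := by
        by_contra! h
        exact hxm ⟨hx0, h⟩
      refine le_mul_of_one_le_right hG ?_
      have hk : (0 : ℝ) ≤ k := Nat.cast_nonneg k
      push_cast
      nlinarith [mul_nonneg hk hxa, mul_le_mul_of_nonneg_left ha hx0.le]
  · rw [integral_const_mul, integral_pow_mul_exp_neg_mul_Ioi (k + 1) ht0]
    push_cast
    ring
end
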